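/- arXiv:1812.03466 — 4 statements merged into one kernel-verified Lean document; each statement's English description precedes it below -/
import Mathlib

section
/- Let k be an algebraically closed field of characteristic 2 and B = k[[x,y]]. Let D be a nonzero 2-closed derivation of B, i.e., the unique extension of D to the fraction field satisfies D∘D = g·D for some g in Frac(B). Then there exist h, R, S, T ∈ k[[x,y]] such that D = h·D′, where D′ is the (unique continuous) k-linear derivation of B with D′(x) = S² + T²·x and D′(y) = R² + T²·y. Moreover D′∘D′ = T²·D′ and D∘D = (D′(h) + h·T²)·D. -/
namespace MvPowerSeries

instance isDomain {σ R : Type*} [CommRing R] [IsDomain R] : IsDomain (MvPowerSeries σ R) :=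
  NoZeroDivisors.to_isDomain _

instance uniqueFactorizationMonoid_fin_two {k : Type*} [Field k] :
    UniqueFactorizationMonoid (MvPowerSeries (Fin 2) k) :=
  let e₁ : MvPowerSeries Unit k ≃ₐ[k] MvPowerSeries (Fin 1) k := renameEquiv k (Equiv.ofUnique _ _)
  have : IsPrincipalIdealRing (MvPowerSeries Unit k) :=
    inferInstanceAs (IsPrincipalIdealRing (PowerSeries k))
  have : IsPrincipalIdealRing (MvPowerSeries (Fin 1) k) :=
    IsPrincipalIdealRing.of_surjective e₁ e₁.surjective
  (finSuccEquiv k 1).symm.toMulEquiv.uniqueFactorizationMonoid inferInstance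

section pderiv

variable {σ k : Type*} [CommRing k]

theorem pderiv_pderiv_comm (i j : σ) (f : MvPowerSeries σ k) :
    pderiv k i (pderiv k j f) = pderiv k j (pderiv k i f) := by
  ext n
  rcases eq_or_ne i j with rfl | h
  · rfl
  · simp [coeff_pderiv, h, h.symm, add_right_comm, mul_right_comm]

theorem pderiv_pderiv_self [CharP k 2] (i : σ) (f : MvPowerSeries σ k) :
    pderiv k i (pderiv k i f) = 0 := by
  ext n
  have h : ((n i + 1 + 1 : k) * (n i + 1)) = 0 := by
    have := (CharP.cast_eq_zero_iff k 2 ((n i + 1 + 1) * (n i + 1))).2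
      (by rw [mul_comm]; exact (Nat.even_mul_succ_self (n i + 1)).two_dvd)
    exact_mod_cast this
  simp [coeff_pderiv, mul_assoc, h]

theorem exists_derivation_apply_X_eq (a b : MvPowerSeries (Fin 2) k) :
    ∃ E : Derivation k (MvPowerSeries (Fin 2) k) (MvPowerSeries (Fin 2) k),
      E (X 0) = a ∧ E (X 1) = b := by
  have h01 : pderiv k 0 (X 1 : MvPowerSeries (Fin 2) k) = 0 := pderiv_X_of_ne (by simp)
  have h10 : pderiv k 1 (X 0 : MvPowerSeries (Fin 2) k) = 0 := pderiv_X_of_ne (by simp)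
  exact ⟨a • pderiv k 0 + b • pderiv k 1, by simp [h10], by simp [h01]⟩

end pderiv

section CharTwo

variable {k : Type*} [Field k] [CharP k 2]

theorem two_eq_zero {σ : Type*} : (2 : MvPowerSeries σ k) = 0 := by
  rw [← map_ofNat (C (σ := σ) (R := k)) 2, CharTwo.two_eq_zero, map_zero]

theorem exists_eq_sq_of_pderiv_eq_zero {σ : Type*} [Finite σ] [PerfectRing k 2]
    (f : MvPowerSeries σ k) (hf : ∀ i, pderiv k i f = 0) : ∃ s, f = s ^ 2 := by
  let s : MvPowerSeries σ k := fun m ↦ (frobeniusEquiv k 2).symm (coeff (2 • m) f)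
  refine ⟨s, ?_⟩
  rw [← map_frobenius_expand 2 two_ne_zero]
  ext n
  rw [coeff_map]
  by_cases h : ∀ i, 2 ∣ n i
  · obtain ⟨m, rfl⟩ : ∃ m, n = 2 • m := by
      refine ⟨n.mapRange (fun a ↦ a / 2) (by simp), ?_⟩
      ext i
      simp [Nat.mul_div_cancel' (h i)]
    rw [coeff_expand_smul]
    exact (frobenius_apply_frobeniusEquiv_symm k 2 _).symm
  · push Not at h
    obtain ⟨i, hi⟩ := h
    rw [coeff_expand_of_not_dvd 2 two_ne_zero _ hi, map_zero]
    obtain ⟨c, hc⟩ : ∃ c, n i = 2 * c + 1 := by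
      exact ⟨n i / 2, by omega⟩
    have := congrArg (coeff (n - Finsupp.single i 1)) (hf i)
    rw [coeff_pderiv, tsub_add_cancel_of_le (by simp [hc])] at this
    simpa [hc, CharTwo.two_eq_zero] using this

theorem exists_eq_sum_sq [PerfectRing k 2] (f : MvPowerSeries (Fin 2) k) :
    ∃ f₀ f₁ f₂ f₃ : MvPowerSeries (Fin 2) k,
      f = f₀ ^ 2 + f₁ ^ 2 * X 0 + f₂ ^ 2 * X 1 + f₃ ^ 2 * (X 0 * X 1) := by
  have h2 : (2 : MvPowerSeries (Fin 2) k) = 0 := two_eq_zero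
  have split (i j : Fin 2) (hij : j ≠ i) (g : MvPowerSeries (Fin 2) k) :
      ∃ u v, g = u + v * X i ∧ pderiv k i u = 0 ∧ pderiv k i v = 0 ∧
        (pderiv k j g = 0 → pderiv k j u = 0 ∧ pderiv k j v = 0) := by
    refine ⟨g + pderiv k i g * X i, pderiv k i g, ?_, ?_, pderiv_pderiv_self i g, fun hg ↦ ?_⟩
    · linear_combination -(pderiv k i g * X i) * h2
    · simp only [map_add, Derivation.leibniz, pderiv_X_self, pderiv_pderiv_self, smul_eq_mul]
      linear_combination (pderiv k i g) * h2
    · simp [Derivation.leibniz, pderiv_pderiv_comm j i, hg, pderiv_X_of_ne hij.symm]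
  have sq (g : MvPowerSeries (Fin 2) k) (h₀ : pderiv k 0 g = 0) (h₁ : pderiv k 1 g = 0) :
      ∃ s, g = s ^ 2 :=
    exists_eq_sq_of_pderiv_eq_zero g (Fin.forall_fin_two.2 ⟨h₀, h₁⟩)
  obtain ⟨u, v, rfl, hu, hv, -⟩ := split 0 1 (by simp) f
  obtain ⟨u₀, u₁, rfl, hu₀, hu₁, hu'⟩ := split 1 0 (by simp) u
  obtain ⟨v₀, v₁, rfl, hv₀, hv₁, hv'⟩ := split 1 0 (by simp) v
  obtain ⟨f₀, rfl⟩ := sq u₀ (hu' hu).1 hu₀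
  obtain ⟨f₂, rfl⟩ := sq u₁ (hu' hu).2 hu₁
  obtain ⟨f₁, rfl⟩ := sq v₀ (hv' hv).1 hv₀
  obtain ⟨f₃, rfl⟩ := sq v₁ (hv' hv).2 hv₁
  exact ⟨f₀, f₁, f₂, f₃, by ring⟩

theorem derivation_sq {σ : Type*} (D : Derivation k (MvPowerSeries σ k) (MvPowerSeries σ k))
    (s : MvPowerSeries σ k) : D (s ^ 2) = 0 := by
  rw [pow_two, D.leibniz, smul_eq_mul]
  linear_combination (s * D s) * (two_eq_zero : (2 : MvPowerSeries σ k) = 0)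

theorem derivation_apply_eq [PerfectRing k 2]
    (D : Derivation k (MvPowerSeries (Fin 2) k) (MvPowerSeries (Fin 2) k))
    (f : MvPowerSeries (Fin 2) k) :
    D f = D (X 0) * pderiv k 0 f + D (X 1) * pderiv k 1 f := by
  obtain ⟨f₀, f₁, f₂, f₃, rfl⟩ := exists_eq_sum_sq f
  have h : pderiv k 0 (X 1 : MvPowerSeries (Fin 2) k) = 0 := pderiv_X_of_ne (by simp)
  have h' : pderiv k 1 (X 0 : MvPowerSeries (Fin 2) k) = 0 := pderiv_X_of_ne (by simp)
  simp only [map_add, Derivation.leibniz, derivation_sq, smul_eq_mul, h, h', pderiv_X_self]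
  ring

end CharTwo
end MvPowerSeries

theorem IsRelPrime.exists_eq_mul_of_mul_eq_mul {B : Type*} [CommRing B] [IsDomain B]
    [DecompositionMonoid B] {a b c d : B} (hab : IsRelPrime a b) (h : a * d = b * c) :
    ∃ l, c = l * a ∧ d = l * b := by
  obtain ⟨l, rfl⟩ : a ∣ c := hab.dvd_of_dvd_mul_left ⟨d, h.symm⟩
  obtain rfl | ha := eq_or_ne a 0
  · have hb : IsUnit b := isRelPrime_zero_left.1 hab
    obtain ⟨m, rfl⟩ := hb.dvd (a := d)
    exact ⟨m, by simp, mul_comm _ _⟩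
  · exact ⟨l, mul_comm _ _, mul_left_cancel₀ ha (by rw [h]; ring)⟩

namespace MvPowerSeries

theorem exists_derivation_derivation_eq_mul {k : Type*} [Field k]
    {D E : Derivation k (MvPowerSeries (Fin 2) k) (MvPowerSeries (Fin 2) k)}
    {c g₁ g₂ : MvPowerSeries (Fin 2) k} (hc : c ≠ 0) (hE : IsRelPrime (E (X 0)) (E (X 1)))
    (hDE : ∀ f, D f = c * E f) (hg₂ : g₂ ≠ 0) (hg : ∀ f, g₂ * D (D f) = g₁ * D f) :
    ∃ l, E (E (X 0)) = l * E (X 0) ∧ E (E (X 1)) = l * E (X 1) := by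
  have key (f) : g₂ * c ^ 2 * E (E f) = (g₁ * c - g₂ * c * E c) * E f := by
    have := hg f
    rw [hDE, hDE, E.leibniz, smul_eq_mul, smul_eq_mul] at this
    linear_combination this
  refine hE.exists_eq_mul_of_mul_eq_mul
    (mul_left_cancel₀ (mul_ne_zero hg₂ (pow_ne_zero 2 hc)) ?_)
  linear_combination E (X 0) * key (X 1) - E (X 1) * key (X 0)

variable {k : Type*} [Field k] [CharP k 2] [PerfectRing k 2]

/-- A derivation `E` with coprime values on the variables and `E ∘ E = l • E` becomes, after
multiplication by a unit, a derivation in normal form. -/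
theorem exists_isUnit_mul_eq_of_isRelPrime
    (E : Derivation k (MvPowerSeries (Fin 2) k) (MvPowerSeries (Fin 2) k))
    (hE : IsRelPrime (E (X 0)) (E (X 1))) {l : MvPowerSeries (Fin 2) k}
    (h₀ : E (E (X 0)) = l * E (X 0)) (h₁ : E (E (X 1)) = l * E (X 1)) :
    ∃ u R S T : MvPowerSeries (Fin 2) k, IsUnit u ∧
      u * E (X 0) = S ^ 2 + T ^ 2 * X 0 ∧ u * E (X 1) = R ^ 2 + T ^ 2 * X 1 := by
  have h2 : (2 : MvPowerSeries (Fin 2) k) = 0 := two_eq_zero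
  have h01 : pderiv k 0 (X 1 : MvPowerSeries (Fin 2) k) = 0 := pderiv_X_of_ne (by simp)
  have h10 : pderiv k 1 (X 0 : MvPowerSeries (Fin 2) k) = 0 := pderiv_X_of_ne (by simp)
  have hEE (f : MvPowerSeries (Fin 2) k) : E (E f) = l * E f := by
    obtain ⟨f₀, f₁, f₂, f₃, rfl⟩ := exists_eq_sum_sq f
    simp only [map_add, Derivation.leibniz, derivation_sq, smul_eq_mul, h₀, h₁,
      map_zero]
    linear_combination (f₃ ^ 2 * E (X 0) * E (X 1)) * h2
  have hl : E l = 0 := by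
    have key (f : MvPowerSeries (Fin 2) k) : E f * E l = 0 := by
      have := hEE (E f)
      rw [hEE f, E.leibniz, hEE f, smul_eq_mul, smul_eq_mul] at this
      linear_combination this
    by_contra hne
    have hx := (mul_eq_zero.1 (key (X 0))).resolve_right hne
    have hy := (mul_eq_zero.1 (key (X 1))).resolve_right hne
    rw [hx, hy] at hE
    exact not_isUnit_zero (isRelPrime_zero_left.1 hE)
  have hEx := derivation_apply_eq E (E (X 0))
  have hEy := derivation_apply_eq E (E (X 1))
  have hEl := derivation_apply_eq E l
  rw [h₀] at hEx
  rw [h₁] at hEy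
  rw [hl] at hEl
  generalize E (X 0) = a at *
  generalize E (X 1) = b at *
  obtain ⟨μ, hμ₁, hμ₂⟩ := hE.exists_eq_mul_of_mul_eq_mul (c := pderiv k 1 a)
    (d := l + pderiv k 0 a) (by linear_combination hEx + (a * pderiv k 0 a) * h2)
  obtain ⟨ν, hν₁, hν₂⟩ := hE.exists_eq_mul_of_mul_eq_mul (c := l + pderiv k 1 b)
    (d := pderiv k 0 b) (by linear_combination -hEy - (b * pderiv k 1 b) * h2)
  obtain ⟨κ, hκ₁, hκ₂⟩ := hE.exists_eq_mul_of_mul_eq_mul (c := pderiv k 1 l)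
    (d := pderiv k 0 l) (by linear_combination -hEl - (b * pderiv k 1 l) * h2)
  obtain ⟨f₀, R, S, T, hf⟩ := exists_eq_sum_sq (a * X 1 + b * X 0 + l * (X 0 * X 1))
  have hx := congrArg (pderiv k 0) hf
  have hy := congrArg (pderiv k 1) hf
  simp only [map_add, Derivation.leibniz, derivation_sq, smul_eq_mul, h01, h10, pderiv_X_self]
    at hx hy
  refine ⟨1 + ν * X 0 + μ * X 1 + κ * (X 0 * X 1), R, S, T, ?_, ?_, ?_⟩
  · simp [isUnit_iff_constantCoeff]
  · linear_combination hy - X 1 * hμ₁ - X 0 * hν₁ - X 0 * X 1 * hκ₁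
  · linear_combination hx - X 1 * hμ₂ - X 0 * hν₂ - X 0 * X 1 * hκ₂

/-- Every nonzero derivation of `k⟦X, Y⟧` is a multiple of one with coprime values on the
variables. -/
theorem exists_derivation_isRelPrime
    {D : Derivation k (MvPowerSeries (Fin 2) k) (MvPowerSeries (Fin 2) k)} (hD : D ≠ 0) :
    ∃ (c : MvPowerSeries (Fin 2) k)
      (E : Derivation k (MvPowerSeries (Fin 2) k) (MvPowerSeries (Fin 2) k)),
      c ≠ 0 ∧ IsRelPrime (E (X 0)) (E (X 1)) ∧ ∀ f, D f = c * E f := by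
  have hne : D (X 0) ≠ 0 ∨ D (X 1) ≠ 0 := by
    by_contra! h
    exact hD (Derivation.ext fun f ↦ by simp [derivation_apply_eq D f, h.1, h.2])
  obtain ⟨a, b, c, hab, ha, hb⟩ : ∃ a b c : MvPowerSeries (Fin 2) k, IsRelPrime a b ∧
      D (X 0) = c * a ∧ D (X 1) = c * b := by
    obtain h | h := hne
    · obtain ⟨a, b, c, hab, ha, hb⟩ :=
        UniqueFactorizationMonoid.exists_reduced_factors _ h (D (X 1))
      exact ⟨a, b, c, hab, ha.symm, hb.symm⟩
    · obtain ⟨b, a, c, hab, hb, ha⟩ :=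
        UniqueFactorizationMonoid.exists_reduced_factors _ h (D (X 0))
      exact ⟨a, b, c, hab.symm, ha.symm, hb.symm⟩
  obtain ⟨E, hEx, hEy⟩ := exists_derivation_apply_X_eq a b
  refine ⟨c, E, ?_, by rwa [hEx, hEy], fun f ↦ ?_⟩
  · rintro rfl
    simp [ha, hb] at hne
  · rw [derivation_apply_eq D, derivation_apply_eq E, hEx, hEy, ha, hb]
    ring

theorem derivation_derivation_eq_of_apply_X_eq
    {D : Derivation k (MvPowerSeries (Fin 2) k) (MvPowerSeries (Fin 2) k)}
    {R S T : MvPowerSeries (Fin 2) k} (hS : D (X 0) = S ^ 2 + T ^ 2 * X 0)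
    (hR : D (X 1) = R ^ 2 + T ^ 2 * X 1) (f : MvPowerSeries (Fin 2) k) :
    D (D f) = T ^ 2 * D f := by
  obtain ⟨f₀, f₁, f₂, f₃, rfl⟩ := exists_eq_sum_sq f
  simp only [map_add, Derivation.leibniz, derivation_sq, smul_eq_mul, hS, hR, map_zero]
  linear_combination (f₃ ^ 2 * (S ^ 2 + T ^ 2 * X 0) * (R ^ 2 + T ^ 2 * X 1)) *
    (two_eq_zero : (2 : MvPowerSeries (Fin 2) k) = 0)

end MvPowerSeries

/-- Let `k` be an algebraically closed field of characteristic `2` and `B = k[[x,y]]`.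
Every nonzero `2`-closed derivation `D` of `B` (the extension of `D` to the fraction
field satisfies `D∘D = g·D`; equivalently, since `D∘D` is again a derivation in
characteristic `2`, there are `g₁, g₂ ∈ B` with `g₂ ≠ 0` and `g₂·D(D f) = g₁·D f` for
all `f`) can be written as `D = h·D'` where `D'` is the derivation of `B` with
`D' x = S² + T²·x` and `D' y = R² + T²·y` for suitable `h, R, S, T ∈ B`; moreover
`D'∘D' = T²·D'` and `D∘D = (D'(h) + h·T²)·D`. -/
theorem normal_form_of_twoClosed_derivation {k : Type*} [Field k] [IsAlgClosed k]
    [CharP k 2]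
    (D : Derivation k (MvPowerSeries (Fin 2) k) (MvPowerSeries (Fin 2) k))
    (hD : D ≠ 0)
    (hclosed : ∃ g₁ g₂ : MvPowerSeries (Fin 2) k, g₂ ≠ 0 ∧
      ∀ f, g₂ * D (D f) = g₁ * D f) :
    ∃ (h R S T : MvPowerSeries (Fin 2) k)
      (D' : Derivation k (MvPowerSeries (Fin 2) k) (MvPowerSeries (Fin 2) k)),
      D' (MvPowerSeries.X 0) = S ^ 2 + T ^ 2 * MvPowerSeries.X 0 ∧
      D' (MvPowerSeries.X 1) = R ^ 2 + T ^ 2 * MvPowerSeries.X 1 ∧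
      (∀ f, D f = h * D' f) ∧
      (∀ f, D' (D' f) = T ^ 2 * D' f) ∧
      (∀ f, D (D f) = (D' h + h * T ^ 2) * D f) := by
  obtain ⟨g₁, g₂, hg₂, hg⟩ := hclosed
  obtain ⟨c, E, hc, hE, hDE⟩ := MvPowerSeries.exists_derivation_isRelPrime hD
  obtain ⟨l, hl₀, hl₁⟩ :=
    MvPowerSeries.exists_derivation_derivation_eq_mul hc hE hDE hg₂ hg
  obtain ⟨u, R, S, T, hu, hS, hR⟩ :=
    MvPowerSeries.exists_isUnit_mul_eq_of_isRelPrime E hE hl₀ hl₁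
  obtain ⟨v, hv⟩ := hu.exists_left_inv
  obtain ⟨D', hD'⟩ : ∃ D' : Derivation k (MvPowerSeries (Fin 2) k) (MvPowerSeries (Fin 2) k),
      ∀ f, D' f = u * E f := ⟨u • E, fun _ ↦ rfl⟩
  rw [← hD'] at hS hR
  have hDD' (f) : D f = c * v * D' f := by
    rw [hD', hDE]
    linear_combination -(c * E f) * hv
  have hD'D' := MvPowerSeries.derivation_derivation_eq_of_apply_X_eq hS hR
  refine ⟨c * v, R, S, T, D', hS, hR, hDD', hD'D', fun f ↦ ?_⟩
  rw [hDD' f, hDD', D'.leibniz, hD'D', smul_eq_mul, smul_eq_mul]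
  ring
end

section
/- Let k be an algebraically closed field of characteristic p > 0 and B = k[[x,y]]. Let D be a nonzero p-closed k-linear derivation of B (D^p = h·D for some h in Frac(B)) such that D(f) is a unit of B for some f ∈ B (equivalently, the ideal (D(x), D(y)) is the unit ideal; D has no fixed points). Then the invariant ring B^D is a two-dimensional regular local ring; more precisely, there is a regular system of parameters (x′, y′) of B with D(x′) = 0 such that B^D = k[[x′, y′^p]], so B^D is isomorphic to a formal power series ring in two variables over k. -/
/-- The subalgebra of invariants of a derivation. -/
def Derivation.invariants {k A : Type*} [CommRing k] [CommRing A] [Algebra k A]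
    (D : Derivation k A A) : Subalgebra k A where
  carrier := {a | D a = 0}
  mul_mem' := by
    intro a b ha hb
    simp only [Set.mem_setOf_eq] at *
    rw [D.leibniz, ha, hb, smul_zero, smul_zero, add_zero]
  add_mem' := by
    intro a b ha hb
    simp only [Set.mem_setOf_eq] at *
    rw [map_add, ha, hb, add_zero]
  algebraMap_mem' := fun c => D.map_algebraMap c

open MvPowerSeries Finset

namespace Derivation

section Algebra

variable {k A : Type*} [Field k] [CommRing A] [Algebra k A]

/-- The iterates of `u * D` are combinations of iterates of `D`, with leading coefficient `u ^ n`. -/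
theorem exists_iterate_eq_sum (D E : Derivation k A A) (u : A) (h : ∀ f, E f = u * D f) (n : ℕ) :
    ∃ c : ℕ → A, c n = u ^ n ∧ ∀ f, (⇑E)^[n] f = ∑ i ∈ range (n + 1), c i * (⇑D)^[i] f := by
  induction n with
  | zero => exact ⟨fun _ => 1, by simp, fun f => by simp⟩
  | succ n ih =>
    obtain ⟨c, hc, hsum⟩ := ih
    refine ⟨fun i => u * ((if i ≤ n then D (c i) else 0) + if i = 0 then 0 else c (i - 1)),
      by simp [hc, pow_succ'], fun f => ?_⟩
    rw [Function.iterate_succ_apply', hsum, h, map_sum]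
    simp only [mul_assoc, ← mul_sum, add_mul, sum_add_distrib, Derivation.leibniz, smul_eq_mul]
    congr 1
    rw [add_comm]
    congr 1
    · rw [sum_range_succ _ (n + 1)]
      simp only [Nat.not_succ_le_self, if_false, zero_mul, add_zero]
      refine sum_congr rfl fun i hi => ?_
      rw [if_pos (Nat.lt_succ_iff.mp (mem_range.mp hi)), mul_comm]
    · rw [sum_range_succ' _ (n + 1)]
      simp [Function.iterate_succ_apply']

theorem iterate_pow_of_apply_eq_one (D : Derivation k A A) {y : A} (hy : D y = 1) (m j : ℕ) :
    (⇑D)^[j] (y ^ m) = (m.descFactorial j : A) * y ^ (m - j) := by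
  induction j with
  | zero => simp
  | succ j ih =>
    rw [Function.iterate_succ_apply', ih, Derivation.leibniz, Derivation.leibniz_pow, hy,
      Derivation.map_natCast, Nat.descFactorial_succ, ← Nat.sub_sub]
    simp only [smul_eq_mul, nsmul_eq_mul, mul_one, mul_zero, add_zero, Nat.cast_mul]
    ring

theorem natCast_isUnit {n : ℕ} (h : (n : k) ≠ 0) : IsUnit (n : A) := by
  simpa using (isUnit_iff_ne_zero.mpr h).map (algebraMap k A)

variable (p : ℕ) [CharP k p]

theorem factorial_cast_ne_zero_of_lt (hp : p.Prime) {n : ℕ} (hn : n < p) :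
    (n.factorial : k) ≠ 0 := by
  rw [Ne, CharP.cast_eq_zero_iff k p, hp.dvd_factorial]
  omega

/-- A `p`-closed derivation becomes `p`-nilpotent after normalizing its value at some `y` to 1. -/
theorem iterate_eq_zero_of_pClosed (hp : p.Prime) (D E : Derivation k A A) {u y h : A}
    (hu : IsUnit u) (hDE : ∀ f, E f = u * D f) (hy : D y = 1)
    (hclosed : ∀ f, (⇑E)^[p] f = h * E f) (f : A) : (⇑D)^[p] f = 0 := by
  obtain ⟨c, hc, hsum⟩ := exists_iterate_eq_sum D E u hDE p
  set d : ℕ → A := fun i => c i - if i = 1 then h * u else 0 with hd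
  have key : ∀ f, u ^ p * (⇑D)^[p] f + ∑ i ∈ range p, d i * (⇑D)^[i] f = 0 := by
    intro f
    have h1 := hsum f
    rw [hclosed, hDE, sum_range_succ, hc] at h1
    have h2 : ∑ i ∈ range p, d i * (⇑D)^[i] f =
        ∑ i ∈ range p, c i * (⇑D)^[i] f - h * u * D f := by
      simp only [hd, sub_mul, sum_sub_distrib, ite_mul, zero_mul]
      rw [sum_ite_eq' (range p) 1, if_pos (mem_range.mpr hp.one_lt)]
      simp
    rw [h2]
    linear_combination -h1
  have hd0 : ∀ m, m < p → d m = 0 := by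
    intro m
    induction m using Nat.strong_induction_on with
    | _ m ih =>
      intro hm
      have h1 := key (y ^ m)
      rw [iterate_pow_of_apply_eq_one D hy, Nat.descFactorial_of_lt hm, Nat.cast_zero, zero_mul,
        mul_zero, zero_add, sum_eq_single m] at h1
      · rw [iterate_pow_of_apply_eq_one D hy, Nat.descFactorial_self, Nat.sub_self, pow_zero,
          mul_one] at h1
        exact (natCast_isUnit (factorial_cast_ne_zero_of_lt (k := k) p hp hm)).mul_left_eq_zero.mp
          h1
      · intro i hi him
        rcases lt_or_gt_of_ne him with hlt | hgt
        · rw [ih i hlt (mem_range.mp hi), zero_mul]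
        · rw [iterate_pow_of_apply_eq_one D hy, Nat.descFactorial_of_lt hgt]
          simp
      · exact fun h => absurd (mem_range.mpr hm) h
  have h1 := key f
  rw [sum_eq_zero fun i hi => by rw [hd0 i (mem_range.mp hi), zero_mul], add_zero] at h1
  exact (hu.pow p).mul_right_eq_zero.mp h1

/-- The alternating Taylor sum `∑ (-1) ^ i / i! * y ^ i * D ^ i b` of length `n`. -/
noncomputable def taylorSum (D : Derivation k A A) (y : A) (n : ℕ) (b : A) : A :=
  ∑ i ∈ range n, ((-1) ^ i * (i.factorial : k)⁻¹) • (y ^ i * (⇑D)^[i] b)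

theorem taylorSum_add (D : Derivation k A A) (y : A) (n : ℕ) (a b : A) :
    taylorSum D y n (a + b) = taylorSum D y n a + taylorSum D y n b := by
  simp only [taylorSum, ← sum_add_distrib, ← smul_add, ← mul_add, iterate_map_add]

theorem iterate_mul_of_apply_eq_zero (D : Derivation k A A) {a : A} (ha : D a = 0) (b : A)
    (n : ℕ) : (⇑D)^[n] (a * b) = a * (⇑D)^[n] b := by
  induction n with
  | zero => rfl
  | succ n ih => simp [Function.iterate_succ_apply', ih, ha]

theorem taylorSum_mul (D : Derivation k A A) (y : A) (n : ℕ) {a : A} (ha : D a = 0) (b : A) :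
    taylorSum D y n (a * b) = a * taylorSum D y n b := by
  simp only [taylorSum, mul_sum, iterate_mul_of_apply_eq_zero D ha]
  exact sum_congr rfl fun i _ => by rw [mul_smul_comm, mul_left_comm]

theorem taylorSum_of_apply_eq_zero (D : Derivation k A A) (y : A) (n : ℕ) {a : A} (ha : D a = 0) :
    taylorSum D y (n + 1) a = a := by
  rw [taylorSum, sum_range_succ', sum_eq_zero]
  · simp
  · intro i _
    rw [Function.iterate_succ_apply, ha, iterate_map_zero, mul_zero, smul_zero]

theorem iterate_mul_of_apply_eq_one (D : Derivation k A A) {y : A} (hy : D y = 1) (b : A)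
    (n : ℕ) : (⇑D)^[n + 1] (y * b) = y * (⇑D)^[n + 1] b + ((n + 1 : k)) • (⇑D)^[n] b := by
  induction n with
  | zero => simp [hy]
  | succ n ih =>
    rw [Function.iterate_succ_apply', ih, map_add, Derivation.leibniz, hy, map_smul,
      ← Function.iterate_succ_apply' (⇑D) (n + 1), ← Function.iterate_succ_apply' (⇑D) n]
    simp only [smul_eq_mul, mul_one, Nat.cast_add, Nat.cast_one, add_smul, one_smul]
    ring

theorem apply_taylorSum (hp : p.Prime) (D : Derivation k A A) {y : A} (hy : D y = 1) (b : A)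
    {n : ℕ} (hn : n < p) : D (taylorSum D y (n + 1) b) =
      ((-1) ^ n * (n.factorial : k)⁻¹) • (y ^ n * (⇑D)^[n + 1] b) := by
  induction n with
  | zero => simp [taylorSum]
  | succ n ih =>
    have hn1 := factorial_cast_ne_zero_of_lt (k := k) p hp hn
    rw [taylorSum, sum_range_succ, ← taylorSum, map_add, ih (by omega), map_smul,
      Derivation.leibniz, Derivation.leibniz_pow, hy, ← Function.iterate_succ_apply' (⇑D)]
    have h2 : ((-1 : k) ^ n * (n.factorial : k)⁻¹) =
        -((-1) ^ (n + 1) * ((n + 1).factorial : k)⁻¹ * (n + 1 : ℕ)) := by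
      rw [Nat.factorial_succ, Nat.cast_mul] at hn1 ⊢
      have := left_ne_zero_of_mul hn1
      have := right_ne_zero_of_mul hn1
      field_simp
      ring
    rw [h2, neg_smul, mul_smul _ ((n + 1 : ℕ) : k), Nat.cast_smul_eq_nsmul, smul_add]
    simp only [smul_eq_mul, mul_one, Nat.add_sub_cancel, smul_mul_assoc,
      mul_comm ((⇑D)^[n + 1] b)]
    ring

theorem taylorSum_mul_self (hp : p.Prime) (D : Derivation k A A) {y : A} (hy : D y = 1) (b : A)
    {n : ℕ} (hn : n < p) : taylorSum D y (n + 1) (y * b) =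
      ((-1) ^ n * (n.factorial : k)⁻¹) • (y ^ (n + 1) * (⇑D)^[n] b) := by
  induction n with
  | zero => simp [taylorSum]
  | succ n ih =>
    have hn1 := factorial_cast_ne_zero_of_lt (k := k) p hp hn
    rw [taylorSum, sum_range_succ, ← taylorSum, ih (by omega), iterate_mul_of_apply_eq_one D hy]
    have h2 : ((-1 : k) ^ n * (n.factorial : k)⁻¹) =
        -((-1) ^ (n + 1) * ((n + 1).factorial : k)⁻¹ * (n + 1)) := by
      rw [Nat.factorial_succ, Nat.cast_mul] at hn1 ⊢
      have := left_ne_zero_of_mul hn1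
      have := right_ne_zero_of_mul hn1
      push_cast at *
      field_simp
      ring
    rw [h2, neg_smul, mul_smul _ (n + 1 : k), mul_add, smul_add, mul_smul_comm, pow_succ y (n + 1),
      mul_assoc _ y]
    abel

end Algebra

end Derivation

namespace MvPowerSeries

variable {k : Type*} [Field k]

theorem eq_zero_of_forall_le_order {f : MvPowerSeries (Fin 2) k} (h : ∀ n : ℕ, (n : ℕ∞) ≤ f.order) :
    f = 0 := by
  rw [← order_eq_top_iff]
  exact ENat.eq_top_iff_forall_ge.mpr h

/-- Krull-style vanishing: a family of power series, each a combination with topologically nilpotent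
coefficients of members of the family, vanishes. -/
theorem eq_zero_of_forall_exists {S : Type*} (F : S → MvPowerSeries (Fin 2) k)
    {a b : MvPowerSeries (Fin 2) k} (ha : constantCoeff a = 0) (hb : constantCoeff b = 0)
    (h : ∀ f, ∃ g g', F f = a * F g + b * F g') (f : S) : F f = 0 := by
  refine eq_zero_of_forall_le_order fun n => ?_
  induction n generalizing f with
  | zero => simp
  | succ n ih =>
    obtain ⟨g, g', e⟩ := h f
    rw [e]
    have aux : ∀ c : MvPowerSeries (Fin 2) k, constantCoeff c = 0 → ∀ g,
        ((n + 1 : ℕ) : ℕ∞) ≤ (c * F g).order := by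
      intro c hc g
      refine le_trans ?_ le_order_mul
      rw [Nat.cast_add, add_comm, Nat.cast_one]
      exact add_le_add (one_le_order_iff_constCoeff_eq_zero.mpr hc) (ih g)
    exact le_trans (le_min (aux a ha g) (aux b hb g')) min_order_le_add

theorem coeff_add_single_X_mul (s : Fin 2) (m : Fin 2 →₀ ℕ) (f : MvPowerSeries (Fin 2) k) :
    coeff (m + Finsupp.single s 1) (X s * f) = coeff m f := by
  rw [X_def, add_comm, coeff_add_monomial_mul, one_mul]

theorem coeff_X_mul_of_eq_zero {s : Fin 2} {m : Fin 2 →₀ ℕ} (h : m s = 0)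
    (f : MvPowerSeries (Fin 2) k) : coeff m (X s * f) = 0 :=
  X_dvd_iff.mp (dvd_mul_right _ _) m h

theorem eq_zero_of_apply_eq_zero {i j : Fin 2} (hij : i ≠ j) {m : Fin 2 →₀ ℕ} (hi : m i = 0)
    (hj : m j = 0) : m = 0 := by
  ext l
  have : l = i ∨ l = j := by omega
  rcases this with rfl | rfl <;> simpa

theorem exists_eq_C_add_X_mul {i j : Fin 2} (hij : i ≠ j) (f : MvPowerSeries (Fin 2) k) :
    ∃ g g', f = C (constantCoeff f) + X i * g + X j * g' := by
  classical
  let g' : MvPowerSeries (Fin 2) k :=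
    fun m => if m i = 0 then coeff (m + Finsupp.single j 1) f else 0
  have hg' : ∀ m, coeff m g' = if m i = 0 then coeff (m + Finsupp.single j 1) f else 0 :=
    fun m => rfl
  suffices h : X i ∣ f - C (constantCoeff f) - X j * g' by
    obtain ⟨g, hg⟩ := h
    exact ⟨g, g', by linear_combination hg⟩
  rw [X_dvd_iff]
  intro m hm
  rw [map_sub, map_sub, coeff_C]
  by_cases hj : m j = 0
  · rw [coeff_X_mul_of_eq_zero hj, if_pos (eq_zero_of_apply_eq_zero hij hm hj),
      eq_zero_of_apply_eq_zero hij hm hj]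
    simp
  · obtain ⟨m', rfl⟩ : ∃ m', m = m' + Finsupp.single j 1 :=
      ⟨m - Finsupp.single j 1, by
        rw [tsub_add_cancel_of_le]
        exact Finsupp.single_le_iff.mpr (by omega)⟩
    have hm' : m' i = 0 := by
      simp only [Finsupp.add_apply] at hm
      omega
    rw [coeff_add_single_X_mul, hg', if_pos hm', if_neg]
    · ring
    · intro h
      rw [h] at hj
      exact hj rfl

theorem X_dvd_of_dvd_X_mul {i j : Fin 2} (hij : i ≠ j) {f : MvPowerSeries (Fin 2) k}
    (h : X j ∣ X i * f) : X j ∣ f := by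
  rw [X_dvd_iff] at h ⊢
  intro m hm
  rw [← coeff_add_single_X_mul i]
  exact h _ (by simp [hm, hij])

theorem X_pow_dvd_of_mul_eq {i j : Fin 2} (hij : i ≠ j) {w a b : MvPowerSeries (Fin 2) k} {n : ℕ}
    (h : (X i - X j * w) * a = X j ^ n * b) : X j ^ n ∣ a := by
  induction n generalizing a with
  | zero => simp
  | succ n ih =>
    have h1 : X j ∣ a := X_dvd_of_dvd_X_mul hij
      ⟨w * a + X j ^ n * b, by linear_combination h⟩
    obtain ⟨a', rfl⟩ := h1
    obtain ⟨c, rfl⟩ : X j ^ n ∣ a' := by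
      refine ih (mul_left_cancel₀ (a := X j) ?_ (by linear_combination h))
      intro h0
      have := congrArg (coeff (Finsupp.single j 1)) h0
      simp at this
    exact ⟨c, by ring⟩

/-- Coefficients of the solution `F` of `F b = C (c b) + X 0 * F (s b) + X 1 * F (t b)`. -/
def shiftCoeff {S : Type*} (c : S → k) (s t : S → S) : ℕ → ℕ → S → k
  | 0, 0, b => c b
  | i + 1, 0, b => shiftCoeff c s t i 0 (s b)
  | 0, j + 1, b => shiftCoeff c s t 0 j (t b)
  | i + 1, j + 1, b => shiftCoeff c s t i (j + 1) (s b) + shiftCoeff c s t (i + 1) j (t b)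

theorem exists_forall_eq_C_add {S : Type*} (c : S → k) (s t : S → S) :
    ∃ F : S → MvPowerSeries (Fin 2) k,
      ∀ b, F b = C (c b) + X 0 * F (s b) + X 1 * F (t b) := by
  classical
  refine ⟨fun b m => shiftCoeff c s t (m 0) (m 1) b, fun b => ?_⟩
  set F : S → MvPowerSeries (Fin 2) k := fun b m => shiftCoeff c s t (m 0) (m 1) b
  have hF : ∀ b m, coeff m (F b) = shiftCoeff c s t (m 0) (m 1) b := fun b m => rfl
  have hX : ∀ (l : Fin 2) (m : Fin 2 →₀ ℕ) (f : MvPowerSeries (Fin 2) k), coeff m (X l * f) =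
      if m l = 0 then 0 else coeff (m - Finsupp.single l 1) f := by
    intro l m f
    split_ifs with h
    · exact coeff_X_mul_of_eq_zero h f
    · rw [← coeff_add_single_X_mul l (m - Finsupp.single l 1), tsub_add_cancel_of_le]
      exact Finsupp.single_le_iff.mpr (by omega)
  have h0 : ∀ m : Fin 2 →₀ ℕ, m = 0 ↔ m 0 = 0 ∧ m 1 = 0 := fun m =>
    ⟨by rintro rfl; simp, fun h => eq_zero_of_apply_eq_zero zero_ne_one h.1 h.2⟩
  ext m
  rw [map_add, map_add, hX, hX, coeff_C, hF, hF, hF]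
  simp only [h0, Finsupp.tsub_apply, Finsupp.single_apply]
  rcases h0' : m 0 with _ | i <;> rcases h1' : m 1 with _ | j <;> simp [shiftCoeff]

end MvPowerSeries

namespace Derivation

variable {k : Type*} [Field k]

theorem exists_taylorSum_eq_sub {A : Type*} [CommRing A] [Algebra k A] (D : Derivation k A A)
    (y : A) (n : ℕ) (b : A) : ∃ w, taylorSum D y (n + 1) b = b - y * w := by
  refine ⟨-∑ i ∈ range n, ((-1) ^ (i + 1) * ((i + 1).factorial : k)⁻¹) •
    (y ^ i * (⇑D)^[i + 1] b), ?_⟩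
  rw [taylorSum, sum_range_succ', mul_neg, sub_neg_eq_add, mul_sum, add_comm]
  congr 1
  · simp
  · exact sum_congr rfl fun i _ => by
      rw [mul_smul_comm, pow_succ' y, mul_assoc y]

/-- Expansion of an invariant power series along `x'` and `y ^ p`, with invariant coefficients. -/
theorem exists_invariant_expansion (p : ℕ) [CharP k p] (hp : p.Prime)
    (D : Derivation k (MvPowerSeries (Fin 2) k) (MvPowerSeries (Fin 2) k)) {i j : Fin 2}
    (hij : i ≠ j) (hj : D (X j) = 1) (hD : ∀ f, (⇑D)^[p] f = 0) {b : MvPowerSeries (Fin 2) k}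
    (hb : D b = 0) : ∃ (c : k) (s t : MvPowerSeries (Fin 2) k), D s = 0 ∧ D t = 0 ∧
      b = C c + taylorSum D (X j) p (X i) * s + X j ^ p * t := by
  obtain ⟨n, rfl⟩ : ∃ n, p = n + 1 := ⟨p - 1, by have := hp.pos; omega⟩
  obtain ⟨w, hw⟩ := exists_taylorSum_eq_sub D (X j) n (X i)
  obtain ⟨g, g', hg⟩ := exists_eq_C_add_X_mul hij b
  have hpi : ∀ f, D (taylorSum D (X j) (n + 1) f) = 0 := fun f => by
    rw [apply_taylorSum (n + 1) hp D hj f n.lt_succ_self, hD, mul_zero, smul_zero]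
  refine ⟨constantCoeff b, taylorSum D (X j) (n + 1) g,
    ((-1) ^ n * (n.factorial : k)⁻¹) • (⇑D)^[n] (g' + w * g), hpi g, ?_, ?_⟩
  · rw [map_smul, ← Function.iterate_succ_apply' (⇑D), hD, smul_zero]
  · have hb' : b = C (constantCoeff b) + taylorSum D (X j) (n + 1) (X i) * g +
        X j * (g' + w * g) := by
      rw [hw]
      linear_combination hg
    have hC : D (C (constantCoeff b)) = 0 := by
      rw [c_eq_algebraMap]
      exact D.map_algebraMap _
    have h := congrArg (taylorSum D (X j) (n + 1)) hb'
    rwa [taylorSum_of_apply_eq_zero D _ n hb, taylorSum_add, taylorSum_add,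
      taylorSum_of_apply_eq_zero D _ n hC, taylorSum_mul D _ _ (hpi _),
      taylorSum_mul_self (n + 1) hp D hj _ n.lt_succ_self, ← mul_smul_comm] at h

theorem exists_isUnit_apply_X (D : Derivation k (MvPowerSeries (Fin 2) k) (MvPowerSeries (Fin 2) k))
    (h : ∃ f, IsUnit (D f)) : ∃ i j : Fin 2, i ≠ j ∧ IsUnit (D (X j)) := by
  obtain ⟨f, hf⟩ := h
  by_contra! hn
  have h0 := hn 1 0 one_ne_zero
  have h1 := hn 0 1 zero_ne_one
  obtain ⟨g, g', hg⟩ := exists_eq_C_add_X_mul (zero_ne_one (α := Fin 2)) f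
  rw [isUnit_iff_constantCoeff, isUnit_iff_ne_zero, not_not] at h0 h1
  rw [hg, c_eq_algebraMap] at hf
  rw [isUnit_iff_constantCoeff] at hf
  simp [h0, h1] at hf

theorem span_pair_eq_maximalIdeal {i j : Fin 2} (hij : i ≠ j) (w : MvPowerSeries (Fin 2) k) :
    Ideal.span {X i - X j * w, X j} = IsLocalRing.maximalIdeal (MvPowerSeries (Fin 2) k) := by
  apply le_antisymm
  · rw [Ideal.span_le]
    rintro f (rfl | rfl) <;>
    simp [isUnit_iff_constantCoeff]
  · intro f hf
    rw [IsLocalRing.mem_maximalIdeal, mem_nonunits_iff, isUnit_iff_constantCoeff,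
      isUnit_iff_ne_zero, not_not] at hf
    obtain ⟨g, g', hg⟩ := exists_eq_C_add_X_mul hij f
    rw [hf, map_zero, zero_add] at hg
    rw [Ideal.mem_span_pair]
    exact ⟨g, w * g + g', by linear_combination -hg⟩

/-- The invariants of a derivation with `D (X j) = 1` and `D ^ p = 0`: substitution of `x'` and
`y ^ p` is injective, with range the kernel of `D`. -/
theorem exists_algHom_of_iterate_eq_zero (p : ℕ) [CharP k p] (hp : p.Prime)
    (D : Derivation k (MvPowerSeries (Fin 2) k) (MvPowerSeries (Fin 2) k)) {i j : Fin 2}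
    (hij : i ≠ j) (hj : D (X j) = 1) (hD : ∀ f, (⇑D)^[p] f = 0) :
    ∃ (w : MvPowerSeries (Fin 2) k) (φ : MvPowerSeries (Fin 2) k →ₐ[k] MvPowerSeries (Fin 2) k),
      D (X i - X j * w) = 0 ∧ φ (X 0) = X i - X j * w ∧ φ (X 1) = X j ^ p ∧
      (∀ f, D (φ f) = 0) ∧ (∀ b, D b = 0 → ∃ f, φ f = b) ∧ Function.Injective φ := by
  obtain ⟨n, rfl⟩ : ∃ n, p = n + 1 := ⟨p - 1, by have := hp.pos; omega⟩
  obtain ⟨w, hw⟩ := exists_taylorSum_eq_sub D (X j) n (X i)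
  set x' : MvPowerSeries (Fin 2) k := X i - X j * w with hx'
  have hx : constantCoeff x' = 0 := by simp [hx']
  have hy : constantCoeff ((X j : MvPowerSeries (Fin 2) k) ^ (n + 1)) = 0 := by simp
  have hDx : D x' = 0 := by
    rw [← hw, apply_taylorSum (n + 1) hp D hj _ n.lt_succ_self, hD, mul_zero, smul_zero]
  have hDy : D (X j ^ (n + 1)) = 0 := by
    have h0 : ((n + 1 : ℕ) : MvPowerSeries (Fin 2) k) = 0 := by
      rw [← _root_.map_natCast (algebraMap k (MvPowerSeries (Fin 2) k)), CharP.cast_eq_zero, map_zero]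
    rw [Derivation.leibniz_pow, ← Nat.cast_smul_eq_nsmul (MvPowerSeries (Fin 2) k), h0, zero_smul]
  have hsub : HasSubst ![x', X j ^ (n + 1)] := hasSubst_of_constantCoeff_zero (by
    intro s
    fin_cases s
    · exact hx
    · exact hy)
  let φ : MvPowerSeries (Fin 2) k →ₐ[k] MvPowerSeries (Fin 2) k := substAlgHom hsub
  have hφ0 : φ (X 0) = x' := substAlgHom_X hsub 0
  have hφ1 : φ (X 1) = X j ^ (n + 1) := substAlgHom_X hsub 1
  have hφC : ∀ c, φ (C c) = C c := fun c => by
    rw [c_eq_algebraMap]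
    exact φ.commutes c
  have hDC : ∀ c, D (C c) = 0 := fun c => by
    rw [c_eq_algebraMap]
    exact D.map_algebraMap c
  have hφ : ∀ c g g', φ (C c + X 0 * g + X 1 * g') = C c + x' * φ g + X j ^ (n + 1) * φ g' := by
    intro c g g'
    rw [map_add, map_add, map_mul, map_mul, hφ0, hφ1, hφC]
  have hDφ : ∀ f, D (φ f) = 0 := by
    refine eq_zero_of_forall_exists (fun f => D (φ f)) hx hy fun f => ?_
    obtain ⟨g, g', hg⟩ := exists_eq_C_add_X_mul (zero_ne_one (α := Fin 2)) f
    refine ⟨g, g', ?_⟩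
    rw [hg, hφ, map_add, map_add, hDC, Derivation.leibniz, Derivation.leibniz, hDx, hDy]
    simp
  have hsurj : ∀ b, D b = 0 → ∃ f, φ f = b := by
    have key : ∀ b : {b // D b = 0}, ∃ (c : k) (s t : {b // D b = 0}),
        b.1 = C c + x' * s.1 + X j ^ (n + 1) * t.1 := fun b => by
      obtain ⟨c, s, t, hs, ht, h⟩ := exists_invariant_expansion (n + 1) hp D hij hj hD b.2
      rw [hw] at h
      exact ⟨c, ⟨s, hs⟩, ⟨t, ht⟩, h⟩
    choose c s t hcst using key
    obtain ⟨F, hF⟩ := exists_forall_eq_C_add c s t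
    intro b hb
    refine ⟨F ⟨b, hb⟩, sub_eq_zero.mp ?_⟩
    refine eq_zero_of_forall_exists (fun b : {b // D b = 0} => φ (F b) - b.1) hx hy (fun b => ?_)
      ⟨b, hb⟩
    refine ⟨s b, t b, ?_⟩
    rw [hF b, hφ]
    linear_combination -hcst b
  refine ⟨w, φ, hDx, hφ0, hφ1, hDφ, hsurj, ?_⟩
  have hinj : ∀ f : {f // φ f = 0}, (f : MvPowerSeries (Fin 2) k) = 0 := by
    refine eq_zero_of_forall_exists Subtype.val (constantCoeff_X 0) (constantCoeff_X 1) ?_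
    rintro ⟨f, hf⟩
    obtain ⟨g, g', hg⟩ := exists_eq_C_add_X_mul (zero_ne_one (α := Fin 2)) f
    rw [hg, hφ] at hf
    have hc : constantCoeff f = 0 := by
      have := congrArg constantCoeff hf
      simpa [hx] using this
    rw [hc, map_zero, zero_add] at hf hg
    obtain ⟨a, ha⟩ := X_pow_dvd_of_mul_eq (n := n + 1) (b := -φ g') hij (w := w) (a := φ g)
      (by linear_combination hf)
    have hX : (X j : MvPowerSeries (Fin 2) k) ^ (n + 1) ≠ 0 := pow_ne_zero _ fun h0 => by
      have := congrArg (coeff (Finsupp.single j 1)) h0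
      simp at this
    have hDa : D a = 0 := by
      have h := hDφ g
      rw [ha, Derivation.leibniz, hDy, smul_zero, add_zero, smul_eq_mul] at h
      exact (mul_eq_zero.mp h).resolve_left hX
    obtain ⟨h, rfl⟩ := hsurj a hDa
    refine ⟨⟨g - X 1 * h, ?_⟩, ⟨g' + X 0 * h, ?_⟩, ?_⟩
    · rw [map_sub, map_mul, hφ1, ha, sub_self]
    · rw [map_add, map_mul, hφ0]
      refine mul_left_cancel₀ hX ?_
      linear_combination hf - x' * ha
    · dsimp only
      linear_combination hg
  rw [injective_iff_map_eq_zero]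
  exact fun f hf => hinj ⟨f, hf⟩

end Derivation

/-- Let `k` be an algebraically closed field of characteristic `p > 0`, `B = k[[x,y]]`,
and `D` a nonzero `p`-closed derivation of `B` without fixed points (`D f` is a unit for
some `f`).  Then there is a regular system of parameters `(x', y')` of `B` with
`D x' = 0` such that the invariant ring `B^D` equals `k[[x', y'^p]]`; in particular `B^D`
is (isomorphic to) a formal power series ring in two variables over `k`, hence a
two-dimensional regular local ring. -/
theorem invariants_of_fixedPointFree_pClosed {k : Type*} [Field k] [IsAlgClosed k]
    (p : ℕ) (hp : p.Prime) [CharP k p]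
    (D : Derivation k (MvPowerSeries (Fin 2) k) (MvPowerSeries (Fin 2) k))
    (hD : D ≠ 0)
    (hclosed : ∃ h₁ h₂ : MvPowerSeries (Fin 2) k, h₂ ≠ 0 ∧
      ∀ f, h₂ * (⇑D)^[p] f = h₁ * D f)
    (hfree : ∃ f, IsUnit (D f)) :
    ∃ x' y' : MvPowerSeries (Fin 2) k,
      Ideal.span {x', y'} = IsLocalRing.maximalIdeal (MvPowerSeries (Fin 2) k) ∧
      D x' = 0 ∧
      ∃ e : MvPowerSeries (Fin 2) k ≃+* D.invariants,
        (e (MvPowerSeries.X 0) : MvPowerSeries (Fin 2) k) = x' ∧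
        (e (MvPowerSeries.X 1) : MvPowerSeries (Fin 2) k) = y' ^ p := by
  obtain ⟨h₁, h₂, hh, hcl⟩ := hclosed
  obtain ⟨i, j, hij, hu⟩ := D.exists_isUnit_apply_X hfree
  obtain ⟨v, hv⟩ := hu.exists_left_inv
  have hDv : ∀ f, D f = D (X j) * (v • D) f := fun f => by
    rw [Derivation.smul_apply, smul_eq_mul]
    linear_combination (-D f) * hv
  have hy : (v • D) (X j) = 1 := hv
  have hcl' : ∀ f, (⇑D)^[p] f = ((⇑D)^[p] (X j) * v) * D f := fun f => by
    refine mul_left_cancel₀ hh ?_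
    linear_combination hcl f - v * D f * hcl (X j) - h₁ * D f * hv
  have hnil := Derivation.iterate_eq_zero_of_pClosed p hp (v • D) D hu hDv hy hcl'
  have hker : ∀ f, D f = 0 ↔ (v • D) f = 0 := fun f => by
    rw [hDv f]
    exact hu.mul_right_eq_zero
  obtain ⟨w, φ, hDx, hφ0, hφ1, hφD, hφs, hφi⟩ :=
    Derivation.exists_algHom_of_iterate_eq_zero p hp (v • D) hij hy hnil
  have hmem : ∀ f, φ f ∈ D.invariants := fun f => (hker _).mpr (hφD f)
  refine ⟨X i - X j * w, X j, Derivation.span_pair_eq_maximalIdeal hij w, (hker _).mpr hDx,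
    RingEquiv.ofBijective (φ.codRestrict D.invariants hmem) ⟨?_, ?_⟩, hφ0, hφ1⟩
  · exact fun f g h => hφi (congrArg Subtype.val h)
  · rintro ⟨b, hb⟩
    obtain ⟨f, rfl⟩ := hφs b ((hker b).mp hb)
    exact ⟨f, rfl⟩
end

section
/- Let k be an algebraically closed field of characteristic 2 and B = k[[x,y]]. Let R, S, T ∈ B have no common non-unit divisor, and let D′ be the k-linear derivation of B with D′(x) = S² + T²x and D′(y) = R² + T²y. If R or S is a unit of B, then the ideal (D′(x), D′(y)) is the unit ideal, and the invariant ring B^{D′} is a two-dimensional regular local ring. -/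
/-- A surjective endomorphism of a Noetherian ring is injective. -/
theorem RingHom.injective_of_surjective_of_isNoetherianRing {A : Type*} [CommRing A]
    [IsNoetherianRing A] (f : A →+* A) (hf : Function.Surjective f) : Function.Injective f := by
  let K : ℕ →o Ideal A :=
    { toFun := fun n => RingHom.ker (f ^ n)
      monotone' := monotone_nat_of_le_succ fun n a ha => by
        rw [RingHom.mem_ker] at ha ⊢
        rw [pow_succ', RingHom.mul_def, RingHom.comp_apply, ha, map_zero] }
  obtain ⟨n, hn⟩ := monotone_stabilizes_iff_noetherian.mpr ‹IsNoetherianRing A› K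
  rw [injective_iff_map_eq_zero]
  intro a ha
  have hsurj : Function.Surjective (f ^ n) := by
    rw [RingHom.coe_pow]
    exact hf.iterate n
  obtain ⟨b, rfl⟩ := hsurj a
  have hb : b ∈ K (n + 1) := by
    change b ∈ RingHom.ker (f ^ (n + 1))
    rwa [RingHom.mem_ker, pow_succ', RingHom.mul_def, RingHom.comp_apply]
  rw [← hn (n + 1) n.le_succ] at hb
  exact hb

/-- In characteristic two, a derivation kills squares. -/
theorem Derivation.map_sq_of_charTwo {k A : Type*} [CommRing k] [CommRing A] [CharP A 2]
    [Algebra k A] (D : Derivation k A A) (a : A) : D (a ^ 2) = 0 := by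
  rw [pow_two, D.leibniz, CharTwo.add_self_eq_zero]

namespace MvPowerSeries

section Basic

variable {k : Type*} [Field k]

theorem mem_span_range_X_of_constantCoeff_eq_zero {b : MvPowerSeries (Fin 2) k}
    (hb : constantCoeff b = 0) :
    b ∈ Ideal.span (Set.range (X : Fin 2 → MvPowerSeries (Fin 2) k)) := by
  let c : MvPowerSeries (Fin 2) k := fun e => coeff (e + Finsupp.single 0 1) b
  have hc : ∀ e, coeff e c = coeff (e + Finsupp.single 0 1) b := fun _ => rfl
  have hdvd : X 1 ∣ b - c * X 0 := by
    rw [X_dvd_iff]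
    intro m hm
    rw [map_sub, X, coeff_mul_monomial]
    by_cases h0 : m 0 = 0
    · have hm0 : m = 0 := by
        ext i
        fin_cases i <;> assumption
      subst hm0
      simpa using hb
    · have hle : Finsupp.single 0 1 ≤ m := by
        rw [Finsupp.single_le_iff]
        omega
      rw [if_pos hle, hc, tsub_add_cancel_of_le hle, mul_one, sub_self]
  obtain ⟨d, hd⟩ := hdvd
  rw [sub_eq_iff_eq_add.mp hd]
  exact add_mem (Ideal.mul_mem_right _ _ (Ideal.subset_span ⟨1, rfl⟩))
    (Ideal.mul_mem_left _ _ (Ideal.subset_span ⟨0, rfl⟩))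

theorem hasSubst_shear (a u : MvPowerSeries (Fin 2) k) :
    HasSubst
      (![X 0, X 0 * a + X 1 * u] : Fin 2 → MvPowerSeries (Fin 2) k) := by
  refine hasSubst_of_constantCoeff_zero fun i => ?_
  fin_cases i <;> simp

/-- The endomorphism `X 0 ↦ X 0`, `X 1 ↦ X 0 * a + X 1 * u`. -/
noncomputable def shear (a u : MvPowerSeries (Fin 2) k) :
    MvPowerSeries (Fin 2) k →ₐ[k] MvPowerSeries (Fin 2) k :=
  substAlgHom (hasSubst_shear a u)

@[simp]
theorem shear_X_zero (a u : MvPowerSeries (Fin 2) k) : shear a u (X 0) = X 0 :=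
  substAlgHom_X (hasSubst_shear a u) 0

@[simp]
theorem shear_X_one (a u : MvPowerSeries (Fin 2) k) : shear a u (X 1) = X 0 * a + X 1 * u :=
  substAlgHom_X (hasSubst_shear a u) 1

theorem shear_bijective (a u : MvPowerSeries (Fin 2) k) (hu : IsUnit u) :
    Function.Bijective (shear a u) := by
  let θ := shear a u
  have h0 : θ (X 0) = X 0 := shear_X_zero a u
  have h1 : θ (X 1) = X 0 * a + X 1 * u := shear_X_one a u
  let I : Ideal (MvPowerSeries (Fin 2) k) := Ideal.span (Set.range X)
  have hX : ∀ i, X i ∈ I := fun i => Ideal.subset_span ⟨i, rfl⟩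
  have hI : I.map θ.toRingHom = I := by
    apply le_antisymm
    · rw [Ideal.map_span, Ideal.span_le]
      rintro _ ⟨_, ⟨i, rfl⟩, rfl⟩
      fin_cases i
      · change θ (X 0) ∈ I
        rw [h0]
        exact hX 0
      · change θ (X 1) ∈ I
        rw [h1]
        exact add_mem (Ideal.mul_mem_right _ _ (hX 0)) (Ideal.mul_mem_right _ _ (hX 1))
    · have hm : ∀ i, θ (X i) ∈ I.map θ.toRingHom := fun i =>
        Ideal.mem_map_of_mem θ.toRingHom (hX i)
      have hm0 : X 0 ∈ I.map θ.toRingHom := h0 ▸ hm 0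
      have hm1 : X 1 ∈ I.map θ.toRingHom := by
        have := hm 1
        rw [h1, Ideal.add_mem_iff_right _ (Ideal.mul_mem_right _ _ hm0)] at this
        exact (Ideal.mul_unit_mem_iff_mem _ hu).mp this
      rw [Ideal.span_le]
      rintro _ ⟨i, rfl⟩
      fin_cases i
      · exact hm0
      · exact hm1
  have : IsAdicComplete I (MvPowerSeries (Fin 2) k) := inferInstance
  have : IsHausdorff (I.map θ.toRingHom) (MvPowerSeries (Fin 2) k) := by
    rw [hI]
    infer_instance
  have hsurj : Function.Surjective θ.toRingHom := by
    refine surjective_of_mk_map_comp_surjective (I := I) θ.toRingHom fun y => ?_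
    obtain ⟨b, rfl⟩ := Ideal.Quotient.mk_surjective y
    refine ⟨C (constantCoeff b), ?_⟩
    have hC : θ.toRingHom (C (constantCoeff b)) = C (constantCoeff b) :=
      θ.commutes (constantCoeff b)
    rw [RingHom.comp_apply, hC, Ideal.Quotient.eq, hI]
    exact mem_span_range_X_of_constantCoeff_eq_zero (by simp)
  exact ⟨θ.toRingHom.injective_of_surjective_of_isNoetherianRing hsurj, hsurj⟩

theorem expand_injective {σ R : Type*} [CommRing R] (p : ℕ) (hp : p ≠ 0) :
    Function.Injective (expand p hp : MvPowerSeries σ R →ₐ[R] MvPowerSeries σ R) := by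
  intro f g h
  ext m
  rw [← coeff_expand_smul p hp, h, coeff_expand_smul]

/-- Splitting a power series in two variables according to the parities of the exponents. -/
theorem exists_eq_expand_two (b : MvPowerSeries (Fin 2) k) :
    ∃ b₀ b₁ b₂ b₃ : MvPowerSeries (Fin 2) k,
      b = expand 2 two_ne_zero b₀ + expand 2 two_ne_zero b₁ * X 1 +
        X 0 * (expand 2 two_ne_zero b₂ + expand 2 two_ne_zero b₃ * X 1) := by
  let E : ℕ × ℕ → (Fin 2 →₀ ℕ) := fun e => Finsupp.single 0 e.1 + Finsupp.single 1 e.2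
  have hE0 : ∀ e, E e 0 = e.1 := fun e => by simp [E]
  have hE1 : ∀ e, E e 1 = e.2 := fun e => by simp [E]
  let q : ℕ × ℕ → MvPowerSeries (Fin 2) k := fun e m => coeff (2 • m + E e) b
  have hq : ∀ e m, coeff m (q e) = coeff (2 • m + E e) b := fun _ _ => rfl
  have hE : ∀ e, monomial (E e) (1 : k) = X 0 ^ e.1 * X 1 ^ e.2 := fun e => by
    rw [X_pow_eq, X_pow_eq, monomial_mul_monomial, one_mul]
  clear_value q E
  have key : b = ∑ e ∈ Finset.range 2 ×ˢ Finset.range 2,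
      expand 2 two_ne_zero (q e) * monomial (E e) 1 := by
    ext n
    have hn : n = 2 • E (n 0 / 2, n 1 / 2) + E (n 0 % 2, n 1 % 2) := by
      ext i
      fin_cases i
      · simp [hE0, Nat.div_add_mod]
      · simp [hE1, Nat.div_add_mod]
    rw [map_sum, Finset.sum_eq_single (n 0 % 2, n 1 % 2)]
    · generalize E (n 0 / 2, n 1 / 2) = m at hn
      generalize (n 0 % 2, n 1 % 2) = e at hn
      rw [hn, coeff_add_mul_monomial, coeff_expand_smul, mul_one, hq]
    · intro e he hne
      simp only [Finset.mem_product, Finset.mem_range] at he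
      rw [coeff_mul_monomial]
      split_ifs with hle
      · have hle0 := hle 0
        have hle1 := hle 1
        rw [hE0] at hle0
        rw [hE1] at hle1
        have hne' : e.1 ≠ n 0 % 2 ∨ e.2 ≠ n 1 % 2 := by
          by_contra! h
          exact hne (Prod.ext h.1 h.2)
        rw [mul_one]
        rcases hne' with h | h
        · refine coeff_expand_of_not_dvd 2 two_ne_zero _ (i := 0) ?_
          rw [Finsupp.tsub_apply, hE0]
          omega
        · refine coeff_expand_of_not_dvd 2 two_ne_zero _ (i := 1) ?_
          rw [Finsupp.tsub_apply, hE1]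
          omega
      · rfl
    · intro h
      exact absurd (Finset.mk_mem_product (Finset.mem_range.mpr (Nat.mod_lt _ two_pos))
        (Finset.mem_range.mpr (Nat.mod_lt _ two_pos))) h
  refine ⟨q (0, 0), q (0, 1), q (1, 0), q (1, 1), key.trans ?_⟩
  simp only [Finset.sum_product, Finset.sum_range_succ, Finset.sum_range_zero, hE]
  ring

theorem expand_two_eq_sq [CharP k 2] [PerfectRing k 2] (b : MvPowerSeries (Fin 2) k) :
    ∃ c, expand 2 two_ne_zero b = c ^ 2 := by
  have : ExpChar k 2 := ExpChar.prime Nat.prime_two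
  refine ⟨map (frobeniusEquiv k 2).symm.toRingHom b, ?_⟩
  rw [← map_frobenius_expand 2 two_ne_zero, map_expand]
  congr 1
  ext m
  simp

end Basic

section SquareVariables

variable (k : Type*) [Field k]

theorem hasSubst_sq_zero : HasSubst (![X 0 ^ 2, X 1] : Fin 2 → MvPowerSeries (Fin 2) k) :=
  hasSubst_of_constantCoeff_zero fun i => by fin_cases i <;> simp

theorem hasSubst_sq_one : HasSubst (![X 0, X 1 ^ 2] : Fin 2 → MvPowerSeries (Fin 2) k) :=
  hasSubst_of_constantCoeff_zero fun i => by fin_cases i <;> simp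

/-- The endomorphism `X 0 ↦ X 0 ^ 2`, `X 1 ↦ X 1`. -/
noncomputable def squareZero : MvPowerSeries (Fin 2) k →ₐ[k] MvPowerSeries (Fin 2) k :=
  substAlgHom (hasSubst_sq_zero k)

/-- The endomorphism `X 0 ↦ X 0`, `X 1 ↦ X 1 ^ 2`. -/
noncomputable def squareOne : MvPowerSeries (Fin 2) k →ₐ[k] MvPowerSeries (Fin 2) k :=
  substAlgHom (hasSubst_sq_one k)

@[simp]
theorem squareZero_X_zero : squareZero k (X 0) = X 0 ^ 2 :=
  substAlgHom_X (hasSubst_sq_zero k) 0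

@[simp]
theorem squareZero_X_one : squareZero k (X 1) = X 1 :=
  substAlgHom_X (hasSubst_sq_zero k) 1

@[simp]
theorem squareOne_X_zero : squareOne k (X 0) = X 0 :=
  substAlgHom_X (hasSubst_sq_one k) 0

@[simp]
theorem squareOne_X_one : squareOne k (X 1) = X 1 ^ 2 :=
  substAlgHom_X (hasSubst_sq_one k) 1

theorem squareZero_squareOne (b : MvPowerSeries (Fin 2) k) :
    squareZero k (squareOne k b) = expand 2 two_ne_zero b := by
  conv_lhs => rw [squareZero, squareOne, substAlgHom_comp_substAlgHom_apply]
  rw [expand, substAlgHom_apply, substAlgHom_apply]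
  congr 1
  funext i
  change squareZero k _ = _
  fin_cases i <;> simp

theorem squareOne_squareZero (b : MvPowerSeries (Fin 2) k) :
    squareOne k (squareZero k b) = expand 2 two_ne_zero b := by
  conv_lhs => rw [squareZero, squareOne, substAlgHom_comp_substAlgHom_apply]
  rw [expand, substAlgHom_apply, substAlgHom_apply]
  congr 1
  funext i
  change squareOne k _ = _
  fin_cases i <;> simp

theorem squareZero_injective : Function.Injective (squareZero k) := by
  intro f g h
  apply expand_injective 2 two_ne_zero
  rw [← squareOne_squareZero, h, squareOne_squareZero]

variable {k}

theorem exists_eq_squareZero_add (b : MvPowerSeries (Fin 2) k) :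
    ∃ b₀ b₁, b = squareZero k b₀ + X 0 * squareZero k b₁ := by
  obtain ⟨c₀, c₁, c₂, c₃, h⟩ := exists_eq_expand_two b
  refine ⟨squareOne k c₀ + squareOne k c₁ * X 1, squareOne k c₂ + squareOne k c₃ * X 1, ?_⟩
  simp only [map_add, map_mul, squareZero_squareOne, squareZero_X_one]
  exact h

end SquareVariables

/-- If `θ` is an automorphism of `k[[x, y]]` with `D (θ x)` a unit and `D (θ y) = 0`, then the
invariants of `D` are the power series in `(θ x) ^ 2` and `θ y`. -/
theorem nonempty_ringEquiv_invariants {k : Type*} [Field k] [CharP k 2] [PerfectRing k 2]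
    (D : Derivation k (MvPowerSeries (Fin 2) k) (MvPowerSeries (Fin 2) k))
    (θ : MvPowerSeries (Fin 2) k →ₐ[k] MvPowerSeries (Fin 2) k) (hθ : Function.Bijective θ)
    (h0 : IsUnit (D (θ (X 0)))) (h1 : D (θ (X 1)) = 0) :
    Nonempty (MvPowerSeries (Fin 2) k ≃+* D.invariants) := by
  have : CharP (MvPowerSeries (Fin 2) k) 2 := charP_of_injective_algebraMap
    (FaithfulSMul.algebraMap_injective k (MvPowerSeries (Fin 2) k)) 2
  let ψ := θ.comp (squareZero k)
  have hψ : ∀ g, ψ g ∈ D.invariants := by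
    intro g
    obtain ⟨c₀, c₁, c₂, c₃, h⟩ := exists_eq_expand_two g
    obtain ⟨d₀, h₀⟩ := expand_two_eq_sq c₀
    obtain ⟨d₁, h₁⟩ := expand_two_eq_sq c₁
    obtain ⟨d₂, h₂⟩ := expand_two_eq_sq c₂
    obtain ⟨d₃, h₃⟩ := expand_two_eq_sq c₃
    change D (ψ g) = 0
    rw [h, h₀, h₁, h₂, h₃]
    simp only [ψ, AlgHom.comp_apply, map_add, map_mul, map_pow, squareZero_X_zero,
      squareZero_X_one, D.leibniz, D.map_sq_of_charTwo, h1, smul_zero, add_zero]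
  have hinj : Function.Injective ψ := hθ.1.comp (squareZero_injective k)
  refine ⟨RingEquiv.ofBijective (ψ.codRestrict D.invariants hψ)
    ⟨fun a b hab => hinj (congrArg Subtype.val hab), ?_⟩⟩
  rintro ⟨b, hb : D b = 0⟩
  obtain ⟨a, rfl⟩ := hθ.2 b
  obtain ⟨a₀, a₁, rfl⟩ := exists_eq_squareZero_add a
  have hψ₀ : D (θ (squareZero k a₀)) = 0 := hψ a₀
  have hψ₁ : D (θ (squareZero k a₁)) = 0 := hψ a₁
  rw [map_add, map_add, map_mul, D.leibniz, hψ₀, hψ₁, smul_zero, zero_add, zero_add, smul_eq_mul,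
    h0.mul_left_eq_zero] at hb
  refine ⟨a₀, Subtype.ext ?_⟩
  simp [ψ, hb]

end MvPowerSeries

/-- Let `k` be an algebraically closed field of characteristic `2`, `B = k[[x,y]]`, and
let `R, S, T ∈ B` have no common non-unit divisor.  Let `D'` be the derivation of `B`
with `D' x = S² + T²x` and `D' y = R² + T²y`.  If `R` or `S` is a unit, then the ideal
`(D' x, D' y)` is the unit ideal and `B^{D'}` is a two-dimensional regular local ring
(it is isomorphic to a formal power series ring in two variables over `k`). -/
theorem twoClosed_unit_case {k : Type*} [Field k] [IsAlgClosed k] [CharP k 2]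
    (R S T : MvPowerSeries (Fin 2) k)
    (hcoprime : ∀ d : MvPowerSeries (Fin 2) k, d ∣ R → d ∣ S → d ∣ T → IsUnit d)
    (D' : Derivation k (MvPowerSeries (Fin 2) k) (MvPowerSeries (Fin 2) k))
    (hx : D' (MvPowerSeries.X 0) = S ^ 2 + T ^ 2 * MvPowerSeries.X 0)
    (hy : D' (MvPowerSeries.X 1) = R ^ 2 + T ^ 2 * MvPowerSeries.X 1)
    (hunit : IsUnit R ∨ IsUnit S) :
    Ideal.span {D' (MvPowerSeries.X 0), D' (MvPowerSeries.X 1)} = ⊤ ∧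
    Nonempty (MvPowerSeries (Fin 2) k ≃+* D'.invariants) := by
  have : CharP (MvPowerSeries (Fin 2) k) 2 := charP_of_injective_algebraMap
    (FaithfulSMul.algebraMap_injective k (MvPowerSeries (Fin 2) k)) 2
  have htwo : (2 : MvPowerSeries (Fin 2) k) = 0 := CharTwo.two_eq_zero
  have : ExpChar k 2 := ExpChar.prime Nat.prime_two
  have hunit_add : ∀ (U V : MvPowerSeries (Fin 2) k) (i : Fin 2), IsUnit U →
      IsUnit (U ^ 2 + V * MvPowerSeries.X i) := fun U V i hU => by
    rw [MvPowerSeries.isUnit_iff_constantCoeff] at hU ⊢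
    simpa using hU.pow 2
  have hf : D' (R ^ 2 * MvPowerSeries.X 0 + S ^ 2 * MvPowerSeries.X 1 +
      T ^ 2 * (MvPowerSeries.X 0 * MvPowerSeries.X 1)) = 0 := by
    simp only [map_add, Derivation.leibniz, Derivation.map_sq_of_charTwo, smul_eq_mul, hx, hy]
    linear_combination (R ^ 2 * S ^ 2 + R ^ 2 * T ^ 2 * MvPowerSeries.X 0 +
      S ^ 2 * T ^ 2 * MvPowerSeries.X 1 +
      T ^ 4 * MvPowerSeries.X 0 * MvPowerSeries.X 1) * htwo
  rcases hunit with hR | hS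
  · have hu := hunit_add R (T ^ 2) 1 hR
    rw [← hy] at hu
    refine ⟨Ideal.eq_top_of_isUnit_mem _ (Ideal.subset_span (by simp)) hu, ?_⟩
    let τ := MvPowerSeries.renameEquiv k (Equiv.swap (0 : Fin 2) 1)
    have hττ : ∀ b, τ (τ b) = b := τ.symm_apply_apply
    have hτ0 : τ (MvPowerSeries.X 0) = MvPowerSeries.X 1 := by simp [τ]
    have hτ1 : τ (MvPowerSeries.X 1) = MvPowerSeries.X 0 := by simp [τ]
    have hV : IsUnit (τ R ^ 2 + τ T ^ 2 * MvPowerSeries.X 0) := hunit_add _ _ _ (hR.map τ)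
    have hbij := MvPowerSeries.shear_bijective (τ S ^ 2) _ hV
    refine MvPowerSeries.nonempty_ringEquiv_invariants D' (τ.toAlgHom.comp
      (MvPowerSeries.shear _ _))
      (τ.bijective.comp hbij) ?_ ?_
    · simpa [hτ0] using hu
    · rw [← hf]
      congr 1
      simp [hτ0, hτ1, hττ]
      ring
  · have hu := hunit_add S (T ^ 2) 0 hS
    rw [← hx] at hu
    refine ⟨Ideal.eq_top_of_isUnit_mem _ (Ideal.subset_span (by simp)) hu, ?_⟩
    refine MvPowerSeries.nonempty_ringEquiv_invariants D' _
      (MvPowerSeries.shear_bijective (R ^ 2) _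
        (hunit_add S (T ^ 2) 0 hS)) ?_ ?_
    · simpa using hu
    · rw [← hf]
      congr 1
      simp
      ring
end

section
/- Let k be an algebraically closed field of characteristic 2 and B = k[[x,y]]. Let R, S, T ∈ B have no common non-unit divisor, and let D′ be the k-linear derivation of B with D′(x) = S² + T²x and D′(y) = R² + T²y. If R and S are non-units and T is a unit of B, then the invariant ring B^{D′} is isomorphic to k[[u,v,w]]/(w² + uv), i.e., B^{D′} is a rational double point of type A₁. -/
theorem Derivation.map_sq_eq_zero {k A : Type*} [CommRing k] [CommRing A] [Algebra k A]
    [CharP A 2] (D : Derivation k A A) (a : A) : D (a ^ 2) = 0 := by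
  rw [D.leibniz_pow, ← Nat.cast_smul_eq_nsmul A, CharP.cast_eq_zero, zero_smul]

/-- A ring endomorphism that is the identity to first order with respect to an ideal for which
the ring is complete is bijective. -/
theorem RingHom.bijective_of_sub_mem_pow {A : Type*} [CommRing A] (I : Ideal A)
    [IsAdicComplete I A] (φ : A →+* A) (h₀ : ∀ a, φ a - a ∈ I) (h₁ : ∀ a ∈ I, φ a - a ∈ I ^ 2) :
    Function.Bijective φ := by
  have step : ∀ n, ∀ a ∈ I ^ n, φ a - a ∈ I ^ (n + 1) := by
    intro n
    induction n with
    | zero => intro a _; simpa using h₀ a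
    | succ n ih =>
      intro a ha
      rw [pow_succ] at ha
      refine Submodule.mul_induction_on ha (fun b hb c hc => ?_) (fun b c hb hc => ?_)
      · have hφc : φ c ∈ I := by
          simpa using I.add_mem (Ideal.pow_le_self two_ne_zero (h₁ c hc)) hc
        have e : φ (b * c) - b * c = (φ b - b) * φ c + b * (φ c - c) := by
          rw [map_mul]; ring
        rw [e]
        refine Ideal.add_mem _ ?_ ?_
        · rw [pow_succ]
          exact Ideal.mul_mem_mul (ih b hb) hφc
        · rw [show n + 1 + 1 = n + 2 by rfl, pow_add]
          exact Ideal.mul_mem_mul hb (h₁ c hc)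
      · have e : φ (b + c) - (b + c) = (φ b - b) + (φ c - c) := by
          rw [map_add]; ring
        rw [e]
        exact Ideal.add_mem _ hb hc
  constructor
  · rw [injective_iff_map_eq_zero]
    intro a ha
    have hmem : ∀ n, a ∈ I ^ n := by
      intro n
      induction n with
      | zero => simp
      | succ n ih => simpa [ha] using step n a ih
    refine IsHausdorff.haus (I := I) inferInstance a fun n => ?_
    rw [SModEq.zero]
    simpa using hmem n
  · intro g
    let f : ℕ → A := fun n => Nat.rec 0 (fun _ x => x + (g - φ x)) n
    have hf : ∀ n, f (n + 1) = f n + (g - φ (f n)) := fun n => rfl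
    have hg : ∀ n, g - φ (f n) ∈ I ^ n := by
      intro n
      induction n with
      | zero => simp
      | succ n ih =>
        have e : g - φ (f (n + 1)) = -(φ (g - φ (f n)) - (g - φ (f n))) := by
          rw [hf, map_add]; ring
        rw [e]
        exact neg_mem (step n _ ih)
    have hcauchy : ∀ {m n}, m ≤ n → f m ≡ f n [SMOD (I ^ m • ⊤ : Submodule A A)] := by
      intro m n hmn
      induction n, hmn using Nat.le_induction with
      | base => rfl
      | succ n hmn ih =>
        refine ih.trans ?_
        rw [SModEq.sub_mem, hf]
        simpa using neg_mem (Ideal.pow_le_pow_right hmn (hg n))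
    obtain ⟨L, hL⟩ := IsPrecomplete.prec (I := I) inferInstance hcauchy
    refine ⟨L, (sub_eq_zero.1 ?_).symm⟩
    refine IsHausdorff.haus (I := I) inferInstance _ fun n => ?_
    rw [SModEq.zero]
    have hn : f n - L ∈ I ^ n := by simpa using (SModEq.sub_mem.1 (hL n))
    have e : g - φ L = (g - φ (f n)) + ((φ (f n - L) - (f n - L)) + (f n - L)) := by
      rw [map_sub]; ring
    rw [e]
    simpa using Ideal.add_mem _ (hg n)
      (Ideal.add_mem _ (Ideal.pow_le_pow_right n.le_succ (step n _ hn)) hn)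

namespace MvPowerSeries

theorem mem_span_range_X_of_constantCoeff_eq_zero_s18 {A : Type*} [CommRing A]
    {f : MvPowerSeries (Fin 2) A} (hf : constantCoeff f = 0) :
    f ∈ Ideal.span (Set.range (X : Fin 2 → MvPowerSeries (Fin 2) A)) := by
  let g : MvPowerSeries (Fin 2) A := fun e => if e 0 = 0 then coeff e f else 0
  have hg : ∀ e, coeff e g = if e 0 = 0 then coeff e f else 0 := fun e => rfl
  have h0 : X 0 ∣ f - g := by
    rw [X_dvd_iff]
    intro m hm
    simp [hg, hm]
  have h1 : X 1 ∣ g := by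
    rw [X_dvd_iff]
    intro m hm
    rw [hg]
    split_ifs with h
    · have : m = 0 := by
        ext i
        fin_cases i <;> simp [h, hm]
      simpa [this] using hf
    · rfl
  have key : ∀ i, ∀ h : MvPowerSeries (Fin 2) A, X i ∣ h →
      h ∈ Ideal.span (Set.range (X : Fin 2 → MvPowerSeries (Fin 2) A)) := fun i h hi =>
    Ideal.mem_of_dvd _ hi (Ideal.subset_span ⟨i, rfl⟩)
  simpa using Ideal.add_mem _ (key 0 _ h0) (key 1 _ h1)

/-- Formal inverse function theorem for substitutions tangent to the identity. -/
theorem bijective_substAlgHom_of_sub_X_mem {A : Type*} [CommRing A]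
    {a : Fin 2 → MvPowerSeries (Fin 2) A} (ha : HasSubst a)
    (h : ∀ i, a i - X i ∈ Ideal.span (Set.range (X : Fin 2 → MvPowerSeries (Fin 2) A)) ^ 2) :
    Function.Bijective (substAlgHom (R := A) ha) := by
  set J := Ideal.span (Set.range (X : Fin 2 → MvPowerSeries (Fin 2) A)) with hJ
  set φ := substAlgHom (R := A) ha
  have φX : ∀ i, φ (X i) = a i := substAlgHom_X ha
  have hmap : ∀ f ∈ J, φ f ∈ J := by
    intro f hf
    have : J ≤ J.comap φ := by
      rw [hJ, Ideal.span_le]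
      rintro _ ⟨i, rfl⟩
      have hX : φ (X i) = (a i - X i) + X i := by simp [φX]
      rw [SetLike.mem_coe, Ideal.mem_comap, hX]
      exact Ideal.add_mem _ (Ideal.pow_le_self two_ne_zero (h i)) (Ideal.subset_span ⟨i, rfl⟩)
    exact this hf
  have h₀ : ∀ f, φ f - f ∈ J := by
    intro f
    have hf : f - C (constantCoeff f) ∈ J :=
      mem_span_range_X_of_constantCoeff_eq_zero_s18 (by simp)
    have hC : φ (C (constantCoeff f)) = C (constantCoeff f) := φ.commutes _
    have e : φ f - f = φ (f - C (constantCoeff f)) - (f - C (constantCoeff f)) := by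
      rw [map_sub, hC]; ring
    rw [e]
    exact sub_mem (hmap _ hf) hf
  refine RingHom.bijective_of_sub_mem_pow J φ.toRingHom h₀ fun f hf => ?_
  change φ f - f ∈ J ^ 2
  refine Submodule.span_induction ?_ ?_ ?_ ?_ hf
  · rintro _ ⟨i, rfl⟩
    simpa [φX] using h i
  · simp
  · intro b c _ _ hb hc
    rw [map_add, add_sub_add_comm]
    exact Ideal.add_mem _ hb hc
  · intro b c hc hbc
    have e : φ (b • c) - b • c = (φ b - b) * φ c + b * (φ c - c) := by
      rw [smul_eq_mul, map_mul]; ring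
    rw [e, pow_two]
    refine Ideal.add_mem _ (Ideal.mul_mem_mul (h₀ b) (hmap c hc)) ?_
    rw [← pow_two]
    exact Ideal.mul_mem_left _ _ hbc

end MvPowerSeries

namespace MvPowerSeries

theorem coeff_two_nsmul_sq {σ k : Type*} [Finite σ] [CommRing k] [CharP k 2]
    (a : MvPowerSeries σ k) (m : σ →₀ ℕ) : coeff (2 • m) (a ^ 2) = coeff m a ^ 2 := by
  have : ExpChar k 2 := ExpChar.prime Nat.prime_two
  rw [← map_frobenius_expand 2 two_ne_zero, coeff_map, coeff_expand_smul, frobenius_def]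

theorem coeff_sq_of_odd {σ k : Type*} [Finite σ] [CommRing k] [CharP k 2]
    (a : MvPowerSeries σ k) {m : σ →₀ ℕ} {i : σ} (h : ¬ 2 ∣ m i) : coeff m (a ^ 2) = 0 := by
  have : ExpChar k 2 := ExpChar.prime Nat.prime_two
  rw [← map_frobenius_expand 2 two_ne_zero, coeff_map, coeff_expand_of_not_dvd 2 _ _ h, map_zero]

theorem coeff_monomial_mul_sq {k : Type*} [CommRing k] [CharP k 2] (g : MvPowerSeries (Fin 2) k)
    (m : Fin 2 →₀ ℕ) {p q p' q' : ℕ} (hp : p < 2) (hq : q < 2) (hp' : p' < 2) (hq' : q' < 2) :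
    coeff (2 • m + (Finsupp.single 0 p + Finsupp.single 1 q))
        (monomial (Finsupp.single 0 p' + Finsupp.single 1 q') 1 * g ^ 2) =
      if p = p' ∧ q = q' then coeff m g ^ 2 else 0 := by
  classical
  split_ifs with h
  · obtain ⟨rfl, rfl⟩ := h
    rw [add_comm, coeff_add_monomial_mul, one_mul, coeff_two_nsmul_sq]
  · rw [coeff_monomial_mul]
    split_ifs with hle
    · rw [one_mul]
      have h0 := hle 0
      have h1 := hle 1
      simp at h0 h1
      rcases not_and_or.1 h with h | h
      · refine coeff_sq_of_odd (i := 0) g ?_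
        simp
        omega
      · refine coeff_sq_of_odd (i := 1) g ?_
        simp
        omega
    · rfl

/-- Over a perfect field of characteristic two, every power series in two variables is a
combination of `1`, `x`, `y`, `xy` with squares as coefficients. -/
theorem exists_eq_sq_add {k : Type*} [Field k] [CharP k 2] [PerfectRing k 2]
    (f : MvPowerSeries (Fin 2) k) : ∃ a b c d : MvPowerSeries (Fin 2) k,
      f = a ^ 2 + X 0 * X 1 * d ^ 2 + (X 0 * b ^ 2 + X 1 * c ^ 2) := by
  have root : ∀ p q : ℕ, ∃ a : MvPowerSeries (Fin 2) k, ∀ m,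
      coeff m a ^ 2 = coeff (2 • m + (Finsupp.single 0 p + Finsupp.single 1 q)) f := fun p q =>
    ⟨fun m => (frobeniusEquiv k 2).symm
      (coeff (2 • m + (Finsupp.single 0 p + Finsupp.single 1 q)) f), fun m =>
      (frobeniusEquiv k 2).apply_symm_apply _⟩
  obtain ⟨a, ha⟩ := root 0 0
  obtain ⟨b, hb⟩ := root 1 0
  obtain ⟨c, hc⟩ := root 0 1
  obtain ⟨d, hd⟩ := root 1 1
  refine ⟨a, b, c, d, ?_⟩
  have parity : ∀ e : Fin 2 →₀ ℕ, ∃ (m : Fin 2 →₀ ℕ) (p q : ℕ), p < 2 ∧ q < 2 ∧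
      e = 2 • m + (Finsupp.single 0 p + Finsupp.single 1 q) := by
    intro e
    refine ⟨Finsupp.single 0 (e 0 / 2) + Finsupp.single 1 (e 1 / 2), e 0 % 2, e 1 % 2,
      Nat.mod_lt _ two_pos, Nat.mod_lt _ two_pos, ?_⟩
    ext i
    fin_cases i <;> simp <;> omega
  have h00 : a ^ 2 = monomial (Finsupp.single 0 0 + Finsupp.single 1 0) 1 * a ^ 2 := by
    simp
  have h11 : (X 0 * X 1 : MvPowerSeries (Fin 2) k) =
      monomial (Finsupp.single 0 1 + Finsupp.single 1 1) 1 := by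
    rw [X, X, monomial_mul_monomial, one_mul]
  have h10 : (X 0 : MvPowerSeries (Fin 2) k) =
      monomial (Finsupp.single 0 1 + Finsupp.single 1 0) 1 := by
    rw [X, Finsupp.single_zero, add_zero]
  have h01 : (X 1 : MvPowerSeries (Fin 2) k) =
      monomial (Finsupp.single 0 0 + Finsupp.single 1 1) 1 := by
    rw [X, Finsupp.single_zero, zero_add]
  ext e
  obtain ⟨m, p, q, hp, hq, rfl⟩ := parity e
  rw [h11, h10, h01, h00]
  simp only [map_add, coeff_monomial_mul_sq _ m hp hq zero_lt_two zero_lt_two,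
    coeff_monomial_mul_sq _ m hp hq one_lt_two one_lt_two,
    coeff_monomial_mul_sq _ m hp hq zero_lt_two one_lt_two,
    coeff_monomial_mul_sq _ m hp hq one_lt_two zero_lt_two, ha, hb, hc, hd]
  interval_cases p <;> interval_cases q <;> simp

theorem eq_zero_of_sq_add_mul_sq_eq_zero {k : Type*} [Field k] [CharP k 2]
    {a b : MvPowerSeries (Fin 2) k} (h : a ^ 2 + X 0 * X 1 * b ^ 2 = 0) : a = 0 ∧ b = 0 := by
  have : CharP (MvPowerSeries (Fin 2) k) 2 := charP_of_injective_algebraMap (R := k)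
    (algebraMap k _).injective 2
  have h' := congrArg (pderiv k 0) h
  have hX : (X 1 : MvPowerSeries (Fin 2) k) ≠ 0 := fun h => by
    simpa using congrArg (coeff (Finsupp.single 1 1)) h
  have hb : b = 0 := by
    simpa [Derivation.leibniz, CharTwo.two_eq_zero (R := MvPowerSeries (Fin 2) k), pderiv_X_self,
      pderiv_X_of_ne, hX] using h'
  subst hb
  simpa using h

/-- Reordering the variables so that the last one becomes the distinguished one. -/
theorem exists_ringEquiv_powerSeries (k : Type*) [CommRing k] :
    ∃ e : MvPowerSeries (Fin 3) k ≃+* PowerSeries (MvPowerSeries (Fin 2) k),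
      e (X 0) = PowerSeries.C (X 0) ∧ e (X 1) = PowerSeries.C (X 1) ∧ e (X 2) = PowerSeries.X := by
  refine ⟨((renameEquiv k (finRotate 3)).trans (finSuccEquiv k 2)).toRingEquiv, ?_, ?_, ?_⟩
  · change finSuccEquiv k 2 (rename _ (X 0)) = _
    rw [rename_X]
    exact finSuccEquiv_X_succ (j := 0)
  · change finSuccEquiv k 2 (rename _ (X 1)) = _
    rw [rename_X]
    exact finSuccEquiv_X_succ (j := 1)
  · change finSuccEquiv k 2 (rename _ (X 2)) = _
    rw [rename_X]
    exact finSuccEquiv_X_zero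

theorem nonempty_quotient_ringEquiv_polynomial_quotient (k : Type*) [CommRing k] [Nontrivial k] :
    Nonempty ((MvPowerSeries (Fin 3) k ⧸ Ideal.span
        ({X 2 ^ 2 + X 0 * X 1} : Set (MvPowerSeries (Fin 3) k))) ≃+*
      (Polynomial (MvPowerSeries (Fin 2) k) ⧸ Ideal.span
        ({Polynomial.X ^ 2 + Polynomial.C (X 0 * X 1)} :
          Set (Polynomial (MvPowerSeries (Fin 2) k))))) := by
  obtain ⟨e, h0, h1, h2⟩ := exists_ringEquiv_powerSeries k
  set g : Polynomial (MvPowerSeries (Fin 2) k) := Polynomial.X ^ 2 + Polynomial.C (X 0 * X 1)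
  have hg : g.IsDistinguishedAt (Ideal.span (Set.range X)) :=
    { monic := Polynomial.monic_X_pow_add_C _ two_ne_zero
      mem := by
        intro n hn
        rw [Polynomial.natDegree_X_pow_add_C] at hn
        have hX : (X 0 * X 1 : MvPowerSeries (Fin 2) k) ∈ Ideal.span (Set.range X) :=
          Ideal.mul_mem_right _ _ (Ideal.subset_span ⟨0, rfl⟩)
        interval_cases n
        · simpa [g] using hX
        · simp [g, Polynomial.coeff_X_pow] }
  refine ⟨(Ideal.quotientEquiv _ (Ideal.span {(g : PowerSeries (MvPowerSeries (Fin 2) k))}) e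
    ?_).trans hg.algEquivQuotient.toRingEquiv.symm⟩
  rw [Ideal.map_span, Set.image_singleton]
  simp [g, h0, h1, h2]

end MvPowerSeries

/-- Let `k` be an algebraically closed field of characteristic `2`, `B = k[[x,y]]`, and
let `R, S, T ∈ B` have no common non-unit divisor.  Let `D'` be the derivation of `B`
with `D' x = S² + T²x` and `D' y = R² + T²y`.  If `R` and `S` are non-units and `T` is a
unit, then `B^{D'}` is isomorphic to `k[[u,v,w]]/(w² + uv)`, i.e. it is a rational double
point of type `A₁`. -/
theorem twoClosed_A1_case {k : Type*} [Field k] [IsAlgClosed k] [CharP k 2]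
    (R S T : MvPowerSeries (Fin 2) k)
    (hcoprime : ∀ d : MvPowerSeries (Fin 2) k, d ∣ R → d ∣ S → d ∣ T → IsUnit d)
    (D' : Derivation k (MvPowerSeries (Fin 2) k) (MvPowerSeries (Fin 2) k))
    (hx : D' (MvPowerSeries.X 0) = S ^ 2 + T ^ 2 * MvPowerSeries.X 0)
    (hy : D' (MvPowerSeries.X 1) = R ^ 2 + T ^ 2 * MvPowerSeries.X 1)
    (hR : ¬ IsUnit R) (hS : ¬ IsUnit S) (hT : IsUnit T) :
    Nonempty ((MvPowerSeries (Fin 3) k ⧸ Ideal.span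
        ({MvPowerSeries.X 2 ^ 2 + MvPowerSeries.X 0 * MvPowerSeries.X 1} :
          Set (MvPowerSeries (Fin 3) k))) ≃+* D'.invariants) := by
  have : CharP (MvPowerSeries (Fin 2) k) 2 := charP_of_injective_algebraMap (R := k)
    (algebraMap k _).injective 2
  have : ExpChar (MvPowerSeries (Fin 2) k) 2 := ExpChar.prime Nat.prime_two
  obtain ⟨t, ht⟩ := hT.exists_right_inv
  have hJ : ∀ P : MvPowerSeries (Fin 2) k, ¬ IsUnit P →
      (P * t) ∈ Ideal.span (Set.range (MvPowerSeries.X : Fin 2 → MvPowerSeries (Fin 2) k)) := by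
    intro P hP
    refine MvPowerSeries.mem_span_range_X_of_constantCoeff_eq_zero_s18 ?_
    rw [MvPowerSeries.isUnit_iff_constantCoeff, isUnit_iff_ne_zero, not_not] at hP
    rw [map_mul, hP, zero_mul]
  let a : Fin 2 → MvPowerSeries (Fin 2) k :=
    ![MvPowerSeries.X 0 + (S * t) ^ 2, MvPowerSeries.X 1 + (R * t) ^ 2]
  have haJ : ∀ i, a i - MvPowerSeries.X i ∈ Ideal.span
      (Set.range (MvPowerSeries.X : Fin 2 → MvPowerSeries (Fin 2) k)) ^ 2 := by
    intro i
    fin_cases i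
    · simpa [a] using Ideal.pow_mem_pow (hJ S hS) 2
    · simpa [a] using Ideal.pow_mem_pow (hJ R hR) 2
  have ha : MvPowerSeries.HasSubst a := by
    refine MvPowerSeries.hasSubst_of_constantCoeff_zero fun i => ?_
    have hR' := hR
    have hS' := hS
    rw [MvPowerSeries.isUnit_iff_constantCoeff, isUnit_iff_ne_zero, not_not] at hR' hS'
    fin_cases i <;> simp [a, hR', hS']
  set φ := MvPowerSeries.substAlgHom (R := k) ha
  have hφ : Function.Bijective φ := MvPowerSeries.bijective_substAlgHom_of_sub_X_mem ha haJ
  have hφ0 : φ (MvPowerSeries.X 0) = MvPowerSeries.X 0 + (S * t) ^ 2 :=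
    MvPowerSeries.substAlgHom_X ha 0
  have hφ1 : φ (MvPowerSeries.X 1) = MvPowerSeries.X 1 + (R * t) ^ 2 :=
    MvPowerSeries.substAlgHom_X ha 1
  have hD0 : D' (φ (MvPowerSeries.X 0)) = T ^ 2 * φ (MvPowerSeries.X 0) := by
    rw [hφ0, map_add, D'.map_sq_eq_zero, hx]
    linear_combination (-(S ^ 2) * (T * t + 1)) * ht
  have hD1 : D' (φ (MvPowerSeries.X 1)) = T ^ 2 * φ (MvPowerSeries.X 1) := by
    rw [hφ1, map_add, D'.map_sq_eq_zero, hy]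
    linear_combination (-(R ^ 2) * (T * t + 1)) * ht
  have hD : ∀ b c d e : MvPowerSeries (Fin 2) k,
      D' (φ (b ^ 2 + MvPowerSeries.X 0 * MvPowerSeries.X 1 * c ^ 2 +
        (MvPowerSeries.X 0 * d ^ 2 + MvPowerSeries.X 1 * e ^ 2))) =
      T ^ 2 * φ (MvPowerSeries.X 0 * d ^ 2 + MvPowerSeries.X 1 * e ^ 2) := by
    intro b c d e
    simp only [map_add, map_mul, map_pow, D'.leibniz, D'.map_sq_eq_zero, hD0, hD1, smul_eq_mul]
    linear_combination φ c ^ 2 * φ (MvPowerSeries.X 0) * φ (MvPowerSeries.X 1) * T ^ 2 *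
      CharTwo.two_eq_zero (R := MvPowerSeries (Fin 2) k)
  have hT0 : T ^ 2 ≠ 0 := pow_ne_zero 2 hT.ne_zero
  let θ : Polynomial (MvPowerSeries (Fin 2) k) →+* MvPowerSeries (Fin 2) k :=
    Polynomial.eval₂RingHom (φ.toRingHom.comp (frobenius _ 2))
      (φ (MvPowerSeries.X 0 * MvPowerSeries.X 1))
  have hθX : θ Polynomial.X = φ (MvPowerSeries.X 0 * MvPowerSeries.X 1) :=
    Polynomial.eval₂_X _ _
  have hθC : ∀ b, θ (Polynomial.C b) = φ (b ^ 2) := fun b => Polynomial.eval₂_C _ _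
  have hθlin : ∀ b c, θ (Polynomial.C c * Polynomial.X + Polynomial.C b) =
      φ (b ^ 2 + MvPowerSeries.X 0 * MvPowerSeries.X 1 * c ^ 2) := by
    intro b c
    rw [map_add, map_mul, hθX, hθC, hθC, map_add, map_mul φ _ (c ^ 2)]
    ring
  set g : Polynomial (MvPowerSeries (Fin 2) k) :=
    Polynomial.X ^ 2 + Polynomial.C (MvPowerSeries.X 0 * MvPowerSeries.X 1)
  have hg : g.Monic := Polynomial.monic_X_pow_add_C _ two_ne_zero
  have hθg : θ g = 0 := by
    rw [map_add, map_pow, hθX, hθC, map_pow, CharTwo.add_self_eq_zero]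
  have hdiv : ∀ p, ∃ b c, p %ₘ g = Polynomial.C c * Polynomial.X + Polynomial.C b ∧
      θ p = φ (b ^ 2 + MvPowerSeries.X 0 * MvPowerSeries.X 1 * c ^ 2) := by
    intro p
    have hdeg : (p %ₘ g).natDegree ≤ 1 := by
      have h2 : g.natDegree = 2 := Polynomial.natDegree_X_pow_add_C
      have := Polynomial.natDegree_modByMonic_lt p hg fun h => by simp [h] at h2
      omega
    obtain ⟨c, b, h⟩ := Polynomial.exists_eq_X_add_C_of_natDegree_le_one hdeg
    refine ⟨b, c, h, ?_⟩
    rw [← hθlin, ← h]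
    conv_lhs => rw [← Polynomial.modByMonic_add_div p g]
    rw [map_add, map_mul, hθg, zero_mul, add_zero]
  have hinv : ∀ p, θ p ∈ D'.invariants := by
    intro p
    obtain ⟨b, c, -, h⟩ := hdiv p
    change D' (θ p) = 0
    simpa [h] using hD b c 0 0
  let ψ : Polynomial (MvPowerSeries (Fin 2) k) →+* D'.invariants :=
    θ.codRestrict D'.invariants hinv
  have hψ : Function.Surjective ψ := by
    rintro ⟨f, hf⟩
    obtain ⟨f, rfl⟩ := hφ.surjective f
    obtain ⟨b, d, e, c, rfl⟩ := MvPowerSeries.exists_eq_sq_add f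
    have h0 : T ^ 2 * φ (MvPowerSeries.X 0 * d ^ 2 + MvPowerSeries.X 1 * e ^ 2) = 0 :=
      (hD b c d e).symm.trans hf
    have h1 := (mul_eq_zero.1 h0).resolve_left hT0
    refine ⟨Polynomial.C c * Polynomial.X + Polynomial.C b, Subtype.ext ?_⟩
    change θ _ = φ _
    rw [hθlin, map_add φ _ (_ + _), h1, add_zero]
  have hker : RingHom.ker ψ = Ideal.span {g} := by
    ext p
    rw [RingHom.mem_ker, Ideal.mem_span_singleton]
    have hp : ψ p = 0 ↔ θ p = 0 := by
      rw [Subtype.ext_iff]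
      rfl
    rw [hp]
    constructor
    · intro h
      obtain ⟨b, c, hmod, hval⟩ := hdiv p
      rw [h, eq_comm, map_eq_zero_iff φ hφ.injective] at hval
      obtain ⟨rfl, rfl⟩ := MvPowerSeries.eq_zero_of_sq_add_mul_sq_eq_zero hval
      rw [← Polynomial.modByMonic_eq_zero_iff_dvd hg, hmod]
      simp
    · rintro ⟨q, rfl⟩
      rw [map_mul, hθg, zero_mul]
  obtain ⟨e⟩ := MvPowerSeries.nonempty_quotient_ringEquiv_polynomial_quotient k
  exact ⟨e.trans ((Ideal.quotEquivOfEq hker.symm).trans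
    (RingHom.quotientKerEquivOfSurjective hψ))⟩
end
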